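/- Let X ⊆ ℂ^m and Y ⊆ ℂ^k be complex algebraic curves and let h : X → Y be a homeomorphism which is a blow-spherical homeomorphism at ∞. Then h extends to a homeomorphism between the projective closures of X and Y: there exists a homeomorphism H : X̄ → Ȳ with H(ι(x)) = ι(h(x)) for all x ∈ X, where X̄ ⊆ ℙ^m(ℂ) and Ȳ ⊆ ℙ^k(ℂ) are the projective closures of X and Y. -/

import Mathlib

open Filter Set Topology

noncomputable section

section TopDefs

variable {α β : Type*} [TopologicalSpace α] [TopologicalSpace β]

/-- `h` restricts to a homeomorphism from `X` onto `Y` (for the subspace topologies). -/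
def IsHomeoOn (h : α → β) (X : Set α) (Y : Set β) : Prop :=
  Set.BijOn h X Y ∧ ContinuousOn h X ∧
    ∃ g : β → α, (∀ x ∈ X, g (h x) = x) ∧ (∀ y ∈ Y, h (g y) = y) ∧ ContinuousOn g Y

/-- `A` is a topological manifold of dimension `d` (charts onto open subsets of `ℝ^d`). -/
def IsTopManifoldOfDim (A : Set α) (d : ℕ) : Prop :=
  ∀ a ∈ A, ∃ W : Set α, IsOpen W ∧ a ∈ W ∧
    ∃ (U : Set (EuclideanSpace ℝ (Fin d))) (f : α → EuclideanSpace ℝ (Fin d)),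
      IsOpen U ∧ IsHomeoOn f (A ∩ W) U

/-- The model half-space in `ℝ^d`. -/
def halfSpace (d : ℕ) : Set (EuclideanSpace ℝ (Fin d)) :=
  {u | ∀ hd : 0 < d, 0 ≤ u ⟨0, hd⟩}

/-- `A` is a topological manifold with boundary of dimension `d`
(charts onto relatively open subsets of the half-space of `ℝ^d`). -/
def IsTopManifoldWithBoundaryOfDim (A : Set α) (d : ℕ) : Prop :=
  ∀ a ∈ A, ∃ W : Set α, IsOpen W ∧ a ∈ W ∧
    ∃ (V : Set (EuclideanSpace ℝ (Fin d))) (f : α → EuclideanSpace ℝ (Fin d)),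
      IsOpen V ∧ IsHomeoOn f (A ∩ W) (V ∩ halfSpace d)

end TopDefs

section BlowSpherical

variable {E F : Type*} [NormedAddCommGroup E] [NormedSpace ℝ E]
  [NormedAddCommGroup F] [NormedSpace ℝ F]

/-- The inverse of the spherical blow-up at `p`, `x ↦ ((x-p)/‖x-p‖, ‖x-p‖)`. -/
def blowupInv (p x : E) : E × ℝ := (‖x - p‖⁻¹ • (x - p), ‖x - p‖)

/-- The inverse of the spherical blow-up at infinity, `x ↦ (x/‖x‖, 1/‖x‖)`. -/
def blowupInvInf (x : E) : E × ℝ := (‖x‖⁻¹ • x, ‖x‖⁻¹)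

/-- The strict transform of `X` under the spherical blow-up at `p`. -/
def strictTransform (X : Set E) (p : E) : Set (E × ℝ) := closure (blowupInv p '' (X \ {p}))

/-- The strict transform of `X` under the spherical blow-up at infinity. -/
def strictTransformInf (X : Set E) : Set (E × ℝ) := closure (blowupInvInf '' (X \ {0}))

/-- The strict transform at `p ∈ E ∪ {∞}`, where `none` stands for `∞`. -/
def strictTransformO (X : Set E) : Option E → Set (E × ℝ)
  | some p => strictTransform X p
  | none => strictTransformInf X

/-- The boundary of a strict transform: the points with second coordinate `0`. -/
def transformBoundary (T : Set (E × ℝ)) : Set (E × ℝ) := {z ∈ T | z.2 = 0}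

/-- The filter of neighbourhoods of infinity within `X`. -/
def atInftyOn (X : Set E) : Filter E :=
  Filter.comap (fun x : E => ‖x‖) Filter.atTop ⊓ Filter.principal X

/-- `q = lim_{x → p} h(x)` where `p ∈ E ∪ {∞}`, `q ∈ F ∪ {∞}` (`none` stands for `∞`). -/
def BSLimit (h : E → F) (X : Set E) : Option E → Option F → Prop
  | some p, some q => Filter.Tendsto h (nhdsWithin p X) (nhds q)
  | some p, none => Filter.Tendsto (fun x => ‖h x‖) (nhdsWithin p X) Filter.atTop
  | none, some q => Filter.Tendsto h (atInftyOn X) (nhds q)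
  | none, none => Filter.Tendsto (fun x => ‖h x‖) (atInftyOn X) Filter.atTop

/-- The inverse of the spherical blow-up at `p ∈ E ∪ {∞}`. -/
def blowupInvO : Option E → E → E × ℝ
  | some p, x => blowupInv p x
  | none, x => blowupInvInf x

/-- `x` is the center of the spherical blow-up at `p ∈ E ∪ {∞}` (at infinity, the center is `0`). -/
def IsCenter : Option E → E → Prop
  | some p, x => x = p
  | none, x => x = 0

/-- `h` is a blow-spherical homeomorphism from `X` onto `Y` at `p ∈ E ∪ {∞}` (with
`q = lim_{x → p} h(x) ∈ F ∪ {∞}`): `h` is a homeomorphism from `X` onto `Y` and the induced map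
between the strict transforms extends to a homeomorphism `Φ` of the strict transforms. -/
def IsBSHomeoAtO (h : E → F) (X : Set E) (Y : Set F) (po : Option E) (qo : Option F) : Prop :=
  IsHomeoOn h X Y ∧ BSLimit h X po qo ∧
    ∃ Φ : E × ℝ → F × ℝ,
      IsHomeoOn Φ (strictTransformO X po) (strictTransformO Y qo) ∧
      ∀ x ∈ X, ¬ IsCenter po x → ¬ IsCenter qo (h x) →
        Φ (blowupInvO po x) = blowupInvO qo (h x)

/-- `h` is a (global) blow-spherical homeomorphism from `X` onto `Y`: it is a blow-spherical
homeomorphism at every `p ∈ closure X ∪ {∞}`. -/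
def IsBSHomeo (h : E → F) (X : Set E) (Y : Set F) : Prop :=
  IsHomeoOn h X Y ∧
    (∀ p ∈ closure X, ∃ qo : Option F, IsBSHomeoAtO h X Y (some p) qo) ∧
    (∃ qo : Option F, IsBSHomeoAtO h X Y none qo)

/-- `X` and `Y` are blow-spherical homeomorphic at infinity: outside suitable compact sets there
is a homeomorphism which is blow-spherical at `∞`. -/
def BSHomeoAtInfinity (X : Set E) (Y : Set F) : Prop :=
  ∃ (K : Set E) (K' : Set F), IsCompact K ∧ IsCompact K' ∧
    ∃ h : E → F, IsBSHomeoAtO h (X \ K) (Y \ K') none none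

/-- The tangent cone of `X` at `p`. -/
def tangConeAt (X : Set E) (p : E) : Set E :=
  {v | ∃ (x : ℕ → E) (t : ℕ → ℝ), (∀ i, x i ∈ X) ∧ (∀ i, 0 < t i) ∧
    Filter.Tendsto x Filter.atTop (nhds p) ∧
    Filter.Tendsto (fun i => (t i)⁻¹ • (x i - p)) Filter.atTop (nhds v)}

/-- The tangent cone of `X` at infinity. -/
def tangConeInf (X : Set E) : Set E :=
  {v | ∃ (x : ℕ → E) (t : ℕ → ℝ), (∀ i, x i ∈ X) ∧ (∀ i, 0 < t i) ∧
    Filter.Tendsto (fun i => ‖x i‖) Filter.atTop Filter.atTop ∧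
    Filter.Tendsto (fun i => (t i)⁻¹ • x i) Filter.atTop (nhds v)}

/-- The tangent cone of `X` at `p ∈ E ∪ {∞}`. -/
def tangConeO (X : Set E) : Option E → Set E
  | some p => tangConeAt X p
  | none => tangConeInf X

/-- `Cone_∞(A) = {t • a : a ∈ A, t ≥ 1}`. -/
def coneInfSet (A : Set E) : Set E := {y | ∃ a ∈ A, ∃ t : ℝ, 1 ≤ t ∧ y = t • a}

/-- The inner distance on `X`: the infimum of lengths of paths in `X` joining `x` to `y`. -/
def innerDist (X : Set E) (x y : E) : ENNReal :=
  ⨅ (γ : ℝ → E) (_ : ContinuousOn γ (Set.Icc 0 1)) (_ : Set.MapsTo γ (Set.Icc 0 1) X)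
    (_ : γ 0 = x) (_ : γ 1 = y), eVariationOn γ (Set.Icc 0 1)

/-- `X` is Lipschitz normally embedded. -/
def IsLNE (X : Set E) : Prop :=
  ∃ c : ℝ, 1 ≤ c ∧ ∀ x ∈ X, ∀ y ∈ X, innerDist X x y ≤ ENNReal.ofReal (c * ‖x - y‖)

/-- `X` is Lipschitz normally embedded at the point `p`. -/
def IsLNEAt (X : Set E) (p : E) : Prop := ∃ U : Set E, IsOpen U ∧ p ∈ U ∧ IsLNE (X ∩ U)

/-- `X` is Lipschitz normally embedded at infinity. -/
def IsLNEAtInf (X : Set E) : Prop := ∃ K : Set E, IsCompact K ∧ IsLNE (X \ K)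

/-- `X` and `Y` are outer lipeomorphic. -/
def OuterLipeo (X : Set E) (Y : Set F) : Prop :=
  ∃ (h : E → F) (lam : ℝ), 1 ≤ lam ∧ Set.BijOn h X Y ∧
    ∀ x ∈ X, ∀ x' ∈ X, lam⁻¹ * ‖x - x'‖ ≤ ‖h x - h x'‖ ∧ ‖h x - h x'‖ ≤ lam * ‖x - x'‖

/-- `X` and `Y` are outer lipeomorphic at infinity. -/
def OuterLipeoAtInf (X : Set E) (Y : Set F) : Prop :=
  ∃ (K : Set E) (K' : Set F), IsCompact K ∧ IsCompact K' ∧ OuterLipeo (X \ K) (Y \ K')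

/-- The ends of `C` relative to `R`: the connected components of `C \ {‖x‖ ≤ R}`. -/
def endsRel (C : Set E) (R : ℝ) : Set (Set E) :=
  {A | ∃ x ∈ C \ Metric.closedBall 0 R, A = connectedComponentIn (C \ Metric.closedBall 0 R) x}

/-- `X` contains a homeomorphic copy of a nonempty open subset of `ℝ^d`. -/
def HasDimGE (X : Set E) (d : ℕ) : Prop :=
  ∃ (U : Set (EuclideanSpace ℝ (Fin d))) (f : EuclideanSpace ℝ (Fin d) → E),
    IsOpen U ∧ U.Nonempty ∧ f '' U ⊆ X ∧ IsHomeoOn f U (f '' U)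

/-- `X` has (topological) dimension `d`. -/
def HasDim (X : Set E) (d : ℕ) : Prop := HasDimGE X d ∧ ¬ HasDimGE X (d + 1)

/-- `x` is a simple point of the boundary of the strict transform `T`, relative to dimension `d`:
near `x`, the connected components of `T` minus the boundary are `d`-dimensional topological
manifolds, and together with the boundary they are topological manifolds with boundary. -/
def IsSimplePointOf (T : Set (E × ℝ)) (d : ℕ) (x : E × ℝ) : Prop :=
  x ∈ transformBoundary T ∧
    ∃ W : Set (E × ℝ), IsOpen W ∧ x ∈ W ∧
      ∀ y ∈ (T ∩ W) \ transformBoundary T,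
        IsTopManifoldOfDim (connectedComponentIn ((T ∩ W) \ transformBoundary T) y) d ∧
        IsTopManifoldWithBoundaryOfDim
          (connectedComponentIn ((T ∩ W) \ transformBoundary T) y ∪ (transformBoundary T ∩ W)) d

/-- `x` is a simple point of the boundary of the strict transform `T` of the set `X`. -/
def IsSimplePoint (X : Set E) (T : Set (E × ℝ)) (x : E × ℝ) : Prop :=
  ∃ d : ℕ, HasDim X d ∧ IsSimplePointOf T d x

/-- The relative multiplicity: for every sufficiently small open neighbourhood `W` of `x`,
the number of connected components of `(T \ ∂T) ∩ W` whose closure contains `x` equals `k`. -/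
def RelMultAt (T : Set (E × ℝ)) (x : E × ℝ) (k : ℕ) : Prop :=
  ∃ W₀ : Set (E × ℝ), IsOpen W₀ ∧ x ∈ W₀ ∧
    ∀ W : Set (E × ℝ), IsOpen W → x ∈ W → W ⊆ W₀ →
      {C : Set (E × ℝ) |
        (∃ y ∈ (T \ transformBoundary T) ∩ W,
          C = connectedComponentIn ((T \ transformBoundary T) ∩ W) y) ∧
        x ∈ closure C}.ncard = k

/-- The relative multiplicity of the end `A` (at infinity) equals `k`: the relative multiplicity
equals `k` on a dense open subset of the boundary of the strict transform at infinity of `A`. -/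
def EndMult (A : Set E) (k : ℕ) : Prop :=
  ∃ U : Set (E × ℝ), IsOpen U ∧
    transformBoundary (strictTransformInf A) ⊆
      closure (transformBoundary (strictTransformInf A) ∩ U) ∧
    ∀ x ∈ transformBoundary (strictTransformInf A) ∩ U, RelMultAt (strictTransformInf A) x k

end BlowSpherical

section Algebraic

/-- `X ⊆ ℝ^n` is semialgebraic. -/
def IsSemialgebraic {n : ℕ} (X : Set (EuclideanSpace ℝ (Fin n))) : Prop :=
  ∃ (m : ℕ) (P : Fin m → MvPolynomial (Fin n) ℝ) (k : Fin m → ℕ)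
    (Q : (i : Fin m) → Fin (k i) → MvPolynomial (Fin n) ℝ),
    X = ⋃ i, {x | MvPolynomial.eval (fun j => x j) (P i) = 0 ∧
      ∀ l, 0 < MvPolynomial.eval (fun j => x j) (Q i l)}

/-- The map `h` is semialgebraic on `X`: its graph over `X` is a semialgebraic set. -/
def IsSemialgebraicMapOn {n m : ℕ} (h : EuclideanSpace ℝ (Fin n) → EuclideanSpace ℝ (Fin m))
    (X : Set (EuclideanSpace ℝ (Fin n))) : Prop :=
  IsSemialgebraic { z : EuclideanSpace ℝ (Fin (n + m)) |
    ∃ x ∈ X, (∀ i : Fin n, z (Fin.castAdd m i) = x i) ∧ ∀ j : Fin m, z (Fin.natAdd n j) = h x j }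

/-- `γ` is a continuous semialgebraic arc on `(ε, ∞)`. -/
def IsSemialgebraicArc {n : ℕ} (γ : ℝ → EuclideanSpace ℝ (Fin n)) (ε : ℝ) : Prop :=
  ContinuousOn γ (Set.Ioi ε) ∧
  IsSemialgebraic { z : EuclideanSpace ℝ (Fin (1 + n)) |
    ∃ t ∈ Set.Ioi ε, z (Fin.castAdd n 0) = t ∧ ∀ j : Fin n, z (Fin.natAdd 1 j) = γ t j }

/-- `X ⊆ ℂ^n` is a complex algebraic set. -/
def IsComplexAlgebraic {n : ℕ} (X : Set (EuclideanSpace ℂ (Fin n))) : Prop :=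
  ∃ (m : ℕ) (P : Fin m → MvPolynomial (Fin n) ℂ),
    X = {x | ∀ i, MvPolynomial.eval (fun j => x j) (P i) = 0}

/-- `X` is an irreducible complex algebraic set. -/
def IsIrreducibleAlg {n : ℕ} (X : Set (EuclideanSpace ℂ (Fin n))) : Prop :=
  X.Nonempty ∧ IsComplexAlgebraic X ∧
    ∀ A B : Set (EuclideanSpace ℂ (Fin n)),
      IsComplexAlgebraic A → IsComplexAlgebraic B → X = A ∪ B → X = A ∨ X = B

/-- `C` is an irreducible component of `X`: a maximal irreducible algebraic subset of `X`. -/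
def IsIrredComponent {n : ℕ} (C X : Set (EuclideanSpace ℂ (Fin n))) : Prop :=
  IsIrreducibleAlg C ∧ C ⊆ X ∧
    ∀ C' : Set (EuclideanSpace ℂ (Fin n)), IsIrreducibleAlg C' → C' ⊆ X → C ⊆ C' → C = C'

/-- The (Krull) dimension of the algebraic set `C` equals `d`: there is a strictly increasing
chain of `d+1` irreducible algebraic sets ending in `C`, and no such chain of `d+2` sets. -/
def HasAlgDim {n : ℕ} (C : Set (EuclideanSpace ℂ (Fin n))) (d : ℕ) : Prop :=
  (∃ f : Fin (d + 1) → Set (EuclideanSpace ℂ (Fin n)),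
    (∀ i, IsIrreducibleAlg (f i)) ∧ StrictMono f ∧ f (Fin.last d) = C) ∧
  ¬ ∃ f : Fin (d + 2) → Set (EuclideanSpace ℂ (Fin n)),
    (∀ i, IsIrreducibleAlg (f i)) ∧ StrictMono f ∧ f (Fin.last (d + 1)) = C

/-- `X ⊆ ℂ^n` is a complex algebraic curve: a nonempty complex algebraic set all of whose
irreducible components have complex dimension 1. -/
def IsComplexAlgebraicCurve {n : ℕ} (X : Set (EuclideanSpace ℂ (Fin n))) : Prop :=
  IsComplexAlgebraic X ∧ X.Nonempty ∧ ∀ C, IsIrredComponent C X → HasAlgDim C 1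

/-- `X ⊆ ℂ^n` is a pure dimensional complex algebraic set. -/
def IsPureDimComplexAlgebraic {n : ℕ} (X : Set (EuclideanSpace ℂ (Fin n))) : Prop :=
  IsComplexAlgebraic X ∧ X.Nonempty ∧ ∃ d, ∀ C, IsIrredComponent C X → HasAlgDim C d

/-- `S` is a 1-dimensional complex submanifold: locally the image of a holomorphic embedding,
with nowhere-vanishing derivative, of an open subset of `ℂ`. -/
def IsOneDimComplexSubmanifold {n : ℕ} (S : Set (EuclideanSpace ℂ (Fin n))) : Prop :=
  ∀ z ∈ S, ∃ (W : Set (EuclideanSpace ℂ (Fin n))) (V : Set ℂ)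
    (f : ℂ → EuclideanSpace ℂ (Fin n)),
    IsOpen W ∧ z ∈ W ∧ IsOpen V ∧ DifferentiableOn ℂ f V ∧ Set.InjOn f V ∧
    (∀ t ∈ V, derivWithin f V t ≠ 0) ∧ f '' V = S ∩ W

/-- The set of singular points of `X ⊆ ℂ^n`. -/
def SingSet {n : ℕ} (X : Set (EuclideanSpace ℂ (Fin n))) : Set (EuclideanSpace ℂ (Fin n)) :=
  {p ∈ X | ¬ ∃ U : Set (EuclideanSpace ℂ (Fin n)), IsOpen U ∧ p ∈ U ∧
    IsOneDimComplexSubmanifold (X ∩ U)}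

/-- The quotient topology on the projectivization `ℙ K V`. -/
instance projectivizationTopology (K V : Type*) [DivisionRing K] [AddCommGroup V] [Module K V]
    [TopologicalSpace V] : TopologicalSpace (Projectivization K V) :=
  inferInstanceAs (TopologicalSpace (Quotient (projectivizationSetoid K V)))

/-- The embedding `ι : ℂ^n → ℙ^n(ℂ)`, `x ↦ [1 : x]`. -/
def projIota {n : ℕ} (x : EuclideanSpace ℂ (Fin n)) : Projectivization ℂ (Fin (n + 1) → ℂ) :=
  Projectivization.mk ℂ (Fin.cons 1 (fun j => x j)) (by
    intro hzero
    have h0 := congrFun hzero 0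
    simp at h0)

end Algebraic

open Polynomial in
theorem exists_ringHom_integralClosure {K A : Type*} [Field K] [IsAlgClosed K] [CommRing A]
    [IsDomain A] [Algebra K[X] A] [FaithfulSMul K[X] A] {b : A} (hb : IsIntegral K[X] b)
    (s t : K) (hst : (minpoly K[X] b).evalEval s t = 0) :
    ∃ φ : integralClosure K[X] A →+* K,
      (∀ g : K[X], φ (algebraMap _ _ g) = g.eval s) ∧ φ ⟨b, hb⟩ = t := by
  set B := integralClosure K[X] A with hB
  set b' : B := ⟨b, hb⟩ with hb'
  let e : K[X][X] →+* K := evalEvalRingHom s t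
  let ψ : K[X][X] →+* B := (aeval b' : K[X][X] →ₐ[K[X]] B).toRingHom
  have hψC : ∀ g : K[X], ψ (C g) = algebraMap _ _ g := fun g => by simp [ψ]
  have hψ : ψ.IsIntegral := by
    have h1 : (ψ.comp (C : K[X] →+* K[X][X])).IsIntegral := by
      have : ψ.comp (C : K[X] →+* K[X][X]) = algebraMap K[X] B := by
        exact RingHom.ext fun g => hψC g
      rw [this]
      exact algebraMap_isIntegral_iff.mpr inferInstance
    exact RingHom.IsIntegral.tower_top _ _ h1
  let _ : Algebra K[X][X] B := ψ.toAlgebra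
  have : Algebra.IsIntegral K[X][X] B := algebraMap_isIntegral_iff.mp hψ
  have : (RingHom.ker e).IsPrime := RingHom.ker_isPrime e
  have hker : (⊥ : Ideal B).comap (algebraMap K[X][X] B) ≤ RingHom.ker e := by
    intro P hP
    have h0 : aeval b' P = 0 := hP
    have h1 : aeval b P = 0 := by
      have := congrArg (algebraMap B A) h0
      rw [map_zero, ← aeval_algebraMap_apply] at this
      exact this
    obtain ⟨R, rfl⟩ := minpoly.isIntegrallyClosed_dvd hb h1
    simp [e, RingHom.mem_ker, hst]
  obtain ⟨Q, -, hQ, hQe⟩ := Ideal.exists_ideal_over_prime_of_isIntegral (RingHom.ker e) ⊥ hker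
  let θ : K[X][X] →+* B ⧸ Q := (Ideal.Quotient.mk Q).comp ψ
  let c : K →+* K[X][X] := (C : K[X] →+* K[X][X]).comp C
  have hθ : ∀ P, θ P = θ (c (e P)) := by
    intro P
    rw [← sub_eq_zero, ← map_sub]
    have : P - c (e P) ∈ Q.comap (algebraMap K[X][X] B) := by
      rw [hQe, RingHom.mem_ker, map_sub]
      simp [e, c]
    exact Ideal.Quotient.eq_zero_iff_mem.mpr this
  have hint : (θ.comp c).IsIntegral := by
    have h1 : θ.IsIntegral :=
      hψ.trans _ _ (RingHom.isIntegral_of_surjective _ Ideal.Quotient.mk_surjective)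
    have h2 : ((θ.comp c).comp e).IsIntegral := by
      have : (θ.comp c).comp e = θ := RingHom.ext fun P => (hθ P).symm
      rwa [this]
    exact RingHom.IsIntegral.tower_top _ _ h2
  let _ : Algebra K (B ⧸ Q) := (θ.comp c).toAlgebra
  have : Algebra.IsIntegral K (B ⧸ Q) := algebraMap_isIntegral_iff.mp hint
  have hbij := IsAlgClosed.algebraMap_bijective_of_isIntegral (k := K) (K := B ⧸ Q)
  let E : K ≃+* B ⧸ Q := RingEquiv.ofBijective _ hbij
  have key : ∀ P, E.symm (Ideal.Quotient.mk Q (ψ P)) = e P := by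
    intro P
    rw [RingEquiv.symm_apply_eq]
    exact hθ P
  refine ⟨E.symm.toRingHom.comp (Ideal.Quotient.mk Q), fun g => ?_, ?_⟩
  · have := key (C g)
    rw [hψC] at this
    simpa [e] using this
  · have := key X
    have hX : ψ X = b' := by simp [ψ]
    rw [hX] at this
    simpa [e] using this

/-- Primes strictly above a prime `p` form no chains of length two. -/
def NoPrimeChain {R : Type*} [CommRing R] (p : Ideal R) : Prop :=
  ∀ q r : Ideal R, q.IsPrime → r.IsPrime → p < q → ¬ q < r

theorem trdeg_quotient_le_one {K : Type*} [Field K] {n : ℕ} (p : Ideal (MvPolynomial (Fin n) K))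
    [p.IsPrime] (hp : NoPrimeChain p) : Algebra.trdeg K (MvPolynomial (Fin n) K ⧸ p) ≤ 1 := by
  obtain ⟨s, g, hg, hgi⟩ := exists_integral_inj_algHom_of_fg K (MvPolynomial (Fin n) K ⧸ p)
  let _ : Algebra (MvPolynomial (Fin s) K) (MvPolynomial (Fin n) K ⧸ p) := g.toRingHom.toAlgebra
  have : IsScalarTower K (MvPolynomial (Fin s) K) (MvPolynomial (Fin n) K ⧸ p) :=
    IsScalarTower.of_algebraMap_eq' g.comp_algebraMap.symm
  have : Algebra.IsIntegral (MvPolynomial (Fin s) K) (MvPolynomial (Fin n) K ⧸ p) :=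
    algebraMap_isIntegral_iff.mp hgi
  have : FaithfulSMul (MvPolynomial (Fin s) K) (MvPolynomial (Fin n) K ⧸ p) :=
    (faithfulSMul_iff_algebraMap_injective _ _).mpr hg
  have hs : s ≤ 1 := by
    by_contra! hs
    let i : Fin s := ⟨0, by omega⟩
    let j : Fin s := ⟨1, by omega⟩
    have hij : i ≠ j := by simp [i, j]
    let P₁ : Ideal (MvPolynomial (Fin s) K) := Ideal.span {MvPolynomial.X i}
    let P₂ : Ideal (MvPolynomial (Fin s) K) := RingHom.ker MvPolynomial.constantCoeff
    have h₁ : P₁.IsPrime := (Ideal.span_singleton_prime (MvPolynomial.X_ne_zero i)).mpr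
      (MvPolynomial.X_prime)
    have h₂ : P₂.IsPrime := RingHom.ker_isPrime _
    have h12 : P₁ ≤ P₂ := by
      rw [Ideal.span_singleton_le_iff_mem, RingHom.mem_ker]; simp
    have h21 : MvPolynomial.X j ∉ P₁ := by
      rw [Ideal.mem_span_singleton, MvPolynomial.X_dvd_X]
      simpa using hij
    have h22 : MvPolynomial.X j ∈ P₂ := by rw [RingHom.mem_ker]; simp
    obtain ⟨Q₁, -, hQ₁, hc₁⟩ := Ideal.exists_ideal_over_prime_of_isIntegral P₁
      (⊥ : Ideal (MvPolynomial (Fin n) K ⧸ p)) (by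
        rw [← RingHom.ker_eq_comap_bot, (RingHom.injective_iff_ker_eq_bot
          (algebraMap (MvPolynomial (Fin s) K) (MvPolynomial (Fin n) K ⧸ p))).mp hg]
        exact bot_le)
    obtain ⟨Q₂, hQ12, hQ₂, hc₂⟩ := Ideal.exists_ideal_over_prime_of_isIntegral P₂ Q₁
      (hc₁.trans_le h12)
    let π := Ideal.Quotient.mk p
    have hπ : Function.Surjective π := Ideal.Quotient.mk_surjective
    have hker : (⊥ : Ideal (MvPolynomial (Fin n) K ⧸ p)).comap π = p := by
      rw [← RingHom.ker_eq_comap_bot]; exact Ideal.mk_ker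
    have hmono : ∀ I J : Ideal (MvPolynomial (Fin n) K ⧸ p), I ≤ J → (∃ x ∈ J, x ∉ I) →
        I.comap π < J.comap π := by
      rintro I J h ⟨x, hx, hx'⟩
      obtain ⟨y, rfl⟩ := hπ x
      exact lt_of_le_of_ne (Ideal.comap_mono h) fun e => hx' (by
        have : y ∈ J.comap π := hx
        rwa [← e] at this)
    refine hp (Q₁.comap π) (Q₂.comap π) inferInstance inferInstance ?_ ?_
    · conv_lhs => rw [← hker]
      refine hmono _ _ bot_le ⟨algebraMap (MvPolynomial (Fin s) K) _ (MvPolynomial.X i), ?_, ?_⟩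
      · rw [← Ideal.mem_comap, hc₁]
        exact Ideal.mem_span_singleton_self _
      · rw [Ideal.mem_bot]
        exact fun h => MvPolynomial.X_ne_zero (R := K) i
          (hg (h.trans (map_zero g).symm))
    · refine hmono _ _ hQ12 ⟨algebraMap (MvPolynomial (Fin s) K) _ (MvPolynomial.X j), ?_, ?_⟩
      · rw [← Ideal.mem_comap, hc₂]; exact h22
      · rw [← Ideal.mem_comap, hc₁]; exact h21
  have h := trdeg_add_eq K (MvPolynomial (Fin s) K) (A := MvPolynomial (Fin n) K ⧸ p)
  have h0 : Algebra.trdeg (MvPolynomial (Fin s) K) (MvPolynomial (Fin n) K ⧸ p) = 0 :=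
    trdeg_eq_zero
  rw [h0, MvPolynomial.trdeg_of_isDomain] at h
  rw [← h]
  simpa using hs

theorem exists_integral_relation_of_isAlgebraic {K A : Type*} [Field K] [IsAlgClosed K]
    [CommRing A] [IsDomain A] [Algebra K A] [Algebra (Polynomial K) A]
    [IsScalarTower K (Polynomial K) A] [FaithfulSMul (Polynomial K) A]
    [Algebra.IsAlgebraic (Polynomial K) A] {n : ℕ} (π : MvPolynomial (Fin n) K →ₐ[K] A)
    (hπ : Function.Surjective π) (l w : MvPolynomial (Fin n) K)
    (hl : algebraMap (Polynomial K) A Polynomial.X = π l) :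
    ∃ (f : Polynomial K) (q : Polynomial (Polynomial K)), f ≠ 0 ∧ q.Monic ∧
      (∀ x ∈ MvPolynomial.zeroLocus K (RingHom.ker π), q.evalEval (MvPolynomial.eval x l)
        (f.eval (MvPolynomial.eval x l) * MvPolynomial.eval x w) = 0) ∧
      ∀ s t : K, f.eval s ≠ 0 → q.evalEval s (f.eval s * t) = 0 →
        ∃ x ∈ MvPolynomial.zeroLocus K (RingHom.ker π), MvPolynomial.eval x l = s ∧
          MvPolynomial.eval x w = t := by
  classical
  obtain ⟨f, hf, hfi⟩ := Algebra.IsAlgebraic.exists_integral_multiples (Polynomial K)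
    (insert (π w) (Finset.univ.image fun j => π (MvPolynomial.X j)))
  have hfw : IsIntegral (Polynomial K) (f • π w) := hfi _ (Finset.mem_insert_self _ _)
  have hfx : ∀ j, IsIntegral (Polynomial K) (f • π (MvPolynomial.X j)) := fun j =>
    hfi _ (Finset.mem_insert_of_mem (Finset.mem_image_of_mem _ (Finset.mem_univ j)))
  have hpow : ∀ a : MvPolynomial (Fin n) K, ∃ N : ℕ, ∀ M ≥ N,
      IsIntegral (Polynomial K) (f ^ M • π a) := by
    intro a
    induction a using MvPolynomial.induction_on with
    | C c =>
      refine ⟨0, fun M _ => ?_⟩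
      have : f ^ M • π (MvPolynomial.C c) =
          algebraMap (Polynomial K) A (f ^ M * Polynomial.C c) := by
        rw [map_mul, Algebra.smul_def, ← Polynomial.algebraMap_eq,
          ← IsScalarTower.algebraMap_apply, ← MvPolynomial.algebraMap_eq, π.commutes]
      rw [this]
      exact isIntegral_algebraMap
    | add a b ha hb =>
      obtain ⟨N₁, h₁⟩ := ha
      obtain ⟨N₂, h₂⟩ := hb
      refine ⟨max N₁ N₂, fun M hM => ?_⟩
      rw [map_add, smul_add]
      exact (h₁ M (le_of_max_le_left hM)).add (h₂ M (le_of_max_le_right hM))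
    | mul_X a j ha =>
      obtain ⟨N, hN⟩ := ha
      refine ⟨N + 1, fun M hM => ?_⟩
      have : f ^ M • π (a * MvPolynomial.X j) =
          (f ^ (M - 1) • π a) * (f • π (MvPolynomial.X j)) := by
        obtain ⟨M, rfl⟩ : ∃ M', M = M' + 1 := ⟨M - 1, by omega⟩
        rw [map_mul, smul_mul_smul_comm, Nat.add_sub_cancel, pow_succ]
      rw [this]
      exact (hN _ (by omega)).mul (hfx j)
  refine ⟨f, minpoly (Polynomial K) (f • π w), hf, minpoly.monic hfw, ?_, ?_⟩
  · intro x hx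
    let ε : A →+* K := (RingHom.liftOfSurjective π.toRingHom hπ
      ⟨MvPolynomial.eval x, fun a ha => by
        simpa [MvPolynomial.aeval_eq_eval] using hx a ha⟩)
    have hε : ∀ a, ε (π a) = MvPolynomial.eval x a := fun a =>
      RingHom.liftOfRightInverse_comp_apply _ _ _ _ _
    have hεi : ε.comp (algebraMap (Polynomial K) A) =
        Polynomial.evalRingHom (MvPolynomial.eval x l) := by
      refine Polynomial.ringHom_ext (fun c => ?_) ?_
      · rw [← Polynomial.algebraMap_eq, RingHom.comp_apply, ← IsScalarTower.algebraMap_apply,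
          ← π.commutes, hε]
        simp [MvPolynomial.algebraMap_eq]
      · simp [hl, hε]
    have hfw' : ε (f • π w) = f.eval (MvPolynomial.eval x l) * MvPolynomial.eval x w := by
      rw [Algebra.smul_def, map_mul, hε, ← RingHom.comp_apply, hεi, Polynomial.coe_evalRingHom]
    have h0 := congrArg ε (minpoly.aeval (Polynomial K) (f • π w))
    rw [map_zero, Polynomial.aeval_def, Polynomial.hom_eval₂, hεi,
      Polynomial.eval₂_evalRingHom, hfw'] at h0
    exact h0
  · intro s t hs hst
    by_contra hcon
    obtain ⟨φ, hφ, hφw⟩ := exists_ringHom_integralClosure hfw s (f.eval s * t) hst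
    let J : Ideal (MvPolynomial (Fin n) K) := RingHom.ker π ⊔
      Ideal.span {l - MvPolynomial.C s, w - MvPolynomial.C t}
    have hJ : J = ⊤ := by
      rw [← Ideal.radical_eq_top, ← MvPolynomial.vanishingIdeal_zeroLocus_eq_radical (K := K),
        ← MvPolynomial.vanishingIdeal_empty (k := K) (K := K)]
      congr 1
      refine Set.eq_empty_of_forall_notMem fun x hx => hcon ⟨x, fun a ha => ?_, ?_, ?_⟩
      · exact hx a (Ideal.mem_sup_left ha)
      · have := hx (l - MvPolynomial.C s)
          (Ideal.mem_sup_right (Ideal.subset_span (by simp)))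
        simpa [sub_eq_zero, MvPolynomial.aeval_eq_eval] using this
      · have := hx (w - MvPolynomial.C t)
          (Ideal.mem_sup_right (Ideal.subset_span (by simp)))
        simpa [sub_eq_zero, MvPolynomial.aeval_eq_eval] using this
    have h1 : (1 : MvPolynomial (Fin n) K) ∈ J := hJ ▸ Submodule.mem_top
    obtain ⟨c, hc, d, hd, hcd⟩ := Submodule.mem_sup.mp h1
    obtain ⟨a, b, hab⟩ := Ideal.mem_span_pair.mp hd
    obtain ⟨N₁, hN₁⟩ := hpow a
    obtain ⟨N₂, hN₂⟩ := hpow b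
    have hN₁ := hN₁ _ (le_max_left N₁ N₂)
    have hN₂ := hN₂ _ (le_max_right N₁ N₂)
    set N := max N₁ N₂
    have hone : π a * (π l - algebraMap K A s) + π b * (π w - algebraMap K A t) = 1 := by
      have := congrArg π hcd
      rw [map_add, show π c = 0 from hc, ← hab] at this
      simpa [← MvPolynomial.algebraMap_eq] using this
    let ι := algebraMap (Polynomial K) (integralClosure (Polynomial K) A)
    have hrel : (⟨_, hN₁⟩ : integralClosure (Polynomial K) A) *
          ι (f * (Polynomial.X - Polynomial.C s)) +
        ⟨_, hN₂⟩ * (⟨_, hfw⟩ - ι (f * Polynomial.C t)) = ι (f ^ (N + 1)) := by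
      apply Subtype.ext
      have hι : ∀ g, ((ι g : integralClosure (Polynomial K) A) : A) = algebraMap _ _ g :=
        fun _ => rfl
      have hC : ∀ c : K, algebraMap (Polynomial K) A (Polynomial.C c) = algebraMap K A c :=
        fun c => by rw [← Polynomial.algebraMap_eq, ← IsScalarTower.algebraMap_apply]
      simp only [Subalgebra.coe_add, Subalgebra.coe_mul, Subalgebra.coe_sub, hι]
      simp only [Algebra.smul_def, map_mul, map_sub, map_pow, hC, hl]
      linear_combination (algebraMap (Polynomial K) A f) ^ (N + 1) * hone
    have h2 := congrArg φ hrel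
    simp only [map_add, map_mul, map_sub, hφw, ι, hφ] at h2
    simp at h2
    exact pow_ne_zero _ hs h2.symm

theorem isAlgebraic_of_noPrimeChain {K : Type*} [Field K] {n : ℕ}
    (p : Ideal (MvPolynomial (Fin n) K)) [p.IsPrime] (hp : NoPrimeChain p)
    [Algebra (Polynomial K) (MvPolynomial (Fin n) K ⧸ p)]
    [IsScalarTower K (Polynomial K) (MvPolynomial (Fin n) K ⧸ p)]
    [FaithfulSMul (Polynomial K) (MvPolynomial (Fin n) K ⧸ p)] :
    Algebra.IsAlgebraic (Polynomial K) (MvPolynomial (Fin n) K ⧸ p) := by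
  have h1 := trdeg_add_eq K (Polynomial K) (A := MvPolynomial (Fin n) K ⧸ p)
  rw [Polynomial.trdeg_of_isDomain] at h1
  have h2 := trdeg_quotient_le_one p hp
  rw [← h1] at h2
  have h3 : Algebra.trdeg (Polynomial K) (MvPolynomial (Fin n) K ⧸ p) < Cardinal.aleph0 :=
    lt_of_le_of_lt (self_le_add_left _ _) (h2.trans_lt Cardinal.one_lt_aleph0)
  rw [← trdeg_eq_zero_iff]
  obtain ⟨k, hk⟩ := Cardinal.lt_aleph0.mp h3
  rw [hk] at h2 ⊢
  have : 1 + k ≤ 1 := by exact_mod_cast h2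
  have : k = 0 := by omega
  simp [this]

theorem exists_integral_relation {K : Type*} [Field K] [IsAlgClosed K] {n : ℕ}
    (p : Ideal (MvPolynomial (Fin n) K)) [p.IsPrime] (hp : NoPrimeChain p)
    (l w : MvPolynomial (Fin n) K)
    (hl : ∀ g : Polynomial K, Polynomial.aeval l g ∈ p → g = 0) :
    ∃ (f : Polynomial K) (q : Polynomial (Polynomial K)), f ≠ 0 ∧ q.Monic ∧
      (∀ x ∈ MvPolynomial.zeroLocus K p, q.evalEval (MvPolynomial.eval x l)
        (f.eval (MvPolynomial.eval x l) * MvPolynomial.eval x w) = 0) ∧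
      ∀ s t : K, f.eval s ≠ 0 → q.evalEval s (f.eval s * t) = 0 →
        ∃ x ∈ MvPolynomial.zeroLocus K p, MvPolynomial.eval x l = s ∧
          MvPolynomial.eval x w = t := by
  let π := Ideal.Quotient.mkₐ K p
  let i : Polynomial K →ₐ[K] MvPolynomial (Fin n) K ⧸ p := Polynomial.aeval (π l)
  have hi : ∀ g, i g = π (Polynomial.aeval l g) := fun g => by
    simp only [i, Polynomial.aeval_algHom_apply]
  let _ : Algebra (Polynomial K) (MvPolynomial (Fin n) K ⧸ p) := i.toRingHom.toAlgebra
  have : IsScalarTower K (Polynomial K) (MvPolynomial (Fin n) K ⧸ p) :=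
    IsScalarTower.of_algebraMap_eq' i.comp_algebraMap.symm
  have : FaithfulSMul (Polynomial K) (MvPolynomial (Fin n) K ⧸ p) := by
    rw [faithfulSMul_iff_algebraMap_injective, injective_iff_map_eq_zero]
    intro g hg
    exact hl g (Ideal.Quotient.eq_zero_iff_mem.mp ((hi g).symm.trans hg))
  have := isAlgebraic_of_noPrimeChain p hp
  have hker : RingHom.ker π = p := Ideal.Quotient.mkₐ_ker K p
  have key := exists_integral_relation_of_isAlgebraic π (Ideal.Quotient.mkₐ_surjective K p) l w
    (Polynomial.aeval_X _)
  rwa [hker] at key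

/-- The zero set in `ℂ^n` of an ideal. -/
def algSet {n : ℕ} (I : Ideal (MvPolynomial (Fin n) ℂ)) : Set (EuclideanSpace ℂ (Fin n)) :=
  {x | ∀ P ∈ I, MvPolynomial.eval (fun j => x j) P = 0}

theorem mem_zeroLocus_iff_mem_algSet {n : ℕ} {I : Ideal (MvPolynomial (Fin n) ℂ)}
    {x : EuclideanSpace ℂ (Fin n)} :
    (fun j => x j) ∈ MvPolynomial.zeroLocus ℂ I ↔ x ∈ algSet I := by
  simp [algSet, MvPolynomial.mem_zeroLocus_iff, MvPolynomial.aeval_eq_eval]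

theorem algSet_span {n : ℕ} (S : Set (MvPolynomial (Fin n) ℂ)) :
    algSet (Ideal.span S) = {x | ∀ P ∈ S, MvPolynomial.eval (fun j => x j) P = 0} := by
  ext x
  refine ⟨fun hx P hP => hx P (Ideal.subset_span hP), fun hx P hP => ?_⟩
  have : Ideal.span S ≤ RingHom.ker (MvPolynomial.eval (fun j => x j)) := Ideal.span_le.mpr hx
  exact this hP

theorem isComplexAlgebraic_algSet {n : ℕ} (I : Ideal (MvPolynomial (Fin n) ℂ)) :
    IsComplexAlgebraic (algSet I) := by
  obtain ⟨m, P, rfl⟩ := Submodule.fg_iff_exists_fin_generating_family.mp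
    (IsNoetherian.noetherian I)
  refine ⟨m, P, ?_⟩
  have := algSet_span (Set.range P)
  simpa using this

theorem IsComplexAlgebraic.exists_eq_algSet {n : ℕ} {X : Set (EuclideanSpace ℂ (Fin n))}
    (hX : IsComplexAlgebraic X) : ∃ I, X = algSet I := by
  obtain ⟨m, P, rfl⟩ := hX
  exact ⟨Ideal.span (Set.range P), by simp [algSet_span]⟩

theorem algSet_anti {n : ℕ} {I J : Ideal (MvPolynomial (Fin n) ℂ)} (h : I ≤ J) :
    algSet J ⊆ algSet I := fun _ hx P hP => hx P (h hP)

theorem algSet_subset_iff {n : ℕ} {p I : Ideal (MvPolynomial (Fin n) ℂ)} [p.IsPrime] :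
    algSet p ⊆ algSet I ↔ I ≤ p := by
  refine ⟨fun h P hP => ?_, algSet_anti⟩
  rw [← MvPolynomial.IsPrime.vanishingIdeal_zeroLocus (K := ℂ) p,
    MvPolynomial.mem_vanishingIdeal_iff]
  intro x hx
  have := h (mem_zeroLocus_iff_mem_algSet (x := WithLp.toLp 2 x).mp hx) P hP
  simpa [MvPolynomial.aeval_eq_eval] using this

theorem algSet_nonempty {n : ℕ} (p : Ideal (MvPolynomial (Fin n) ℂ)) [hp : p.IsPrime] :
    (algSet p).Nonempty := by
  rw [Set.nonempty_iff_ne_empty]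
  intro h
  exact hp.ne_top (top_le_iff.mp (algSet_subset_iff.mp (by rw [h]; exact empty_subset _)))

theorem algSet_mul {n : ℕ} (I J : Ideal (MvPolynomial (Fin n) ℂ)) :
    algSet (I * J) = algSet I ∪ algSet J := by
  refine Subset.antisymm (fun x hx => ?_)
    (union_subset (algSet_anti Ideal.mul_le_left) (algSet_anti Ideal.mul_le_right))
  by_contra! hcon
  simp only [mem_union, not_or, algSet, mem_ofPred_eq, not_forall] at hcon
  obtain ⟨⟨P, hP, hP'⟩, Q, hQ, hQ'⟩ := hcon
  have := hx _ (Ideal.mul_mem_mul hP hQ)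
  rw [map_mul] at this
  exact (mul_ne_zero hP' hQ') this

theorem isIrreducibleAlg_algSet {n : ℕ} (p : Ideal (MvPolynomial (Fin n) ℂ)) [hp : p.IsPrime] :
    IsIrreducibleAlg (algSet p) := by
  refine ⟨algSet_nonempty p, isComplexAlgebraic_algSet p, fun A B hA hB h => ?_⟩
  obtain ⟨I, rfl⟩ := hA.exists_eq_algSet
  obtain ⟨J, rfl⟩ := hB.exists_eq_algSet
  rcases hp.mul_le.mp (algSet_subset_iff.mp (h.trans (algSet_mul I J).symm).subset) with hI | hJ
  · exact Or.inl ((algSet_anti hI).antisymm (h ▸ subset_union_left))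
  · exact Or.inr ((algSet_anti hJ).antisymm (h ▸ subset_union_right))

theorem IsIrreducibleAlg.exists_prime {n : ℕ} {C : Set (EuclideanSpace ℂ (Fin n))}
    (hC : IsIrreducibleAlg C) :
    ∃ p : Ideal (MvPolynomial (Fin n) ℂ), p.IsPrime ∧ C = algSet p := by
  obtain ⟨⟨x₀, hx₀⟩, hCa, hC⟩ := hC
  obtain ⟨I, rfl⟩ := hCa.exists_eq_algSet
  let p : Ideal (MvPolynomial (Fin n) ℂ) :=
    ⨅ x ∈ algSet I, RingHom.ker (MvPolynomial.eval (fun j => x j))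
  have hp : ∀ P, P ∈ p ↔ ∀ x ∈ algSet I, MvPolynomial.eval (fun j => x j) P = 0 := by
    intro P; simp [p, RingHom.mem_ker]
  refine ⟨p, ⟨fun h => ?_, fun {P Q} hPQ => ?_⟩, ?_⟩
  · have : (1 : MvPolynomial (Fin n) ℂ) ∈ p := h ▸ Submodule.mem_top
    simpa using (hp 1).mp this x₀ hx₀
  · have h := hC (algSet (I ⊔ Ideal.span {P})) (algSet (I ⊔ Ideal.span {Q}))
      (isComplexAlgebraic_algSet _) (isComplexAlgebraic_algSet _) ?_
    · have key : ∀ P, algSet I = algSet (I ⊔ Ideal.span {P}) → P ∈ p := fun P h =>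
        (hp P).mpr fun x hx => (h ▸ hx : x ∈ algSet (I ⊔ Ideal.span {P})) P
          (Ideal.mem_sup_right (Ideal.mem_span_singleton_self P))
      exact h.imp (key P) (key Q)
    · refine Subset.antisymm (fun x hx => ?_)
        (union_subset (algSet_anti le_sup_left) (algSet_anti le_sup_left))
      have h0 := (hp _).mp hPQ x hx
      rw [map_mul] at h0
      have key : ∀ P, MvPolynomial.eval (fun j => x j) P = 0 →
          x ∈ algSet (I ⊔ Ideal.span {P}) := by
        intro P hP R hR
        have : I ⊔ Ideal.span {P} ≤ RingHom.ker (MvPolynomial.eval (fun j => x j)) := by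
          rw [sup_le_iff, Ideal.span_singleton_le_iff_mem]
          exact ⟨hx, hP⟩
        exact this hR
      exact (mul_eq_zero.mp h0).imp (key P) (key Q)
  · refine Subset.antisymm (fun x hx P hP => (hp P).mp hP x hx) (algSet_anti fun P hP => ?_)
    exact (hp P).mpr fun x hx => hx P hP

theorem isIrredComponent_algSet {n : ℕ} {p I : Ideal (MvPolynomial (Fin n) ℂ)}
    (hp : p ∈ I.minimalPrimes) : IsIrredComponent (algSet p) (algSet I) := by
  have hprime : p.IsPrime := hp.1.1
  refine ⟨isIrreducibleAlg_algSet p, algSet_anti hp.1.2, fun C' hC' hC'I hpC' => ?_⟩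
  obtain ⟨q, hq, rfl⟩ := hC'.exists_prime
  have hqp : q ≤ p := algSet_subset_iff.mp hpC'
  exact hpC'.antisymm (algSet_anti (hp.2 ⟨hq, algSet_subset_iff.mp hC'I⟩ hqp))

theorem HasAlgDim.noPrimeChain {n : ℕ} {p : Ideal (MvPolynomial (Fin n) ℂ)} [p.IsPrime]
    (h : HasAlgDim (algSet p) 1) : NoPrimeChain p := by
  intro q r hq hr hpq hqr
  have key : ∀ a b : Ideal (MvPolynomial (Fin n) ℂ), a.IsPrime → b.IsPrime → a < b →
      algSet b < algSet a := fun a b ha hb hab =>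
    lt_of_le_not_ge (algSet_anti hab.le) fun h => hab.not_ge (algSet_subset_iff.mp h)
  refine h.2 ⟨![algSet r, algSet q, algSet p], fun i => ?_, ?_, rfl⟩
  · fin_cases i <;> exact isIrreducibleAlg_algSet _
  · rw [Fin.strictMono_iff_lt_succ]
    intro i
    fin_cases i
    · exact key q r hq hr hqr
    · exact key p q inferInstance hq hpq

theorem IsComplexAlgebraicCurve.exists_finite_primes {n : ℕ} {X : Set (EuclideanSpace ℂ (Fin n))}
    (hX : IsComplexAlgebraicCurve X) :
    ∃ S : Set (Ideal (MvPolynomial (Fin n) ℂ)), S.Finite ∧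
      (∀ p ∈ S, p.IsPrime ∧ NoPrimeChain p) ∧ X = ⋃ p ∈ S, algSet p := by
  obtain ⟨hXa, -, hdim⟩ := hX
  obtain ⟨I, rfl⟩ := hXa.exists_eq_algSet
  refine ⟨I.minimalPrimes, I.finite_minimalPrimes_of_isNoetherianRing, fun p hp => ?_, ?_⟩
  · have hprime : p.IsPrime := hp.1.1
    exact ⟨hprime, (hdim _ (isIrredComponent_algSet hp)).noPrimeChain⟩
  · refine Subset.antisymm (fun x hx => ?_) (iUnion₂_subset fun p hp => algSet_anti hp.1.2)
    have : (RingHom.ker (MvPolynomial.eval (R := ℂ) (fun j => x j))).IsPrime :=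
      RingHom.ker_isPrime _
    obtain ⟨p, hp, hpx⟩ := Ideal.exists_minimalPrimes_le
      (J := RingHom.ker (MvPolynomial.eval (fun j => x j))) (I := I) hx
    exact mem_iUnion₂.mpr ⟨p, hp, fun P hP => hpx hP⟩

theorem eval_smul_of_isHomogeneous {σ R : Type*} [CommSemiring R]
    {P : MvPolynomial σ R} {N : ℕ} (hP : P.IsHomogeneous N) (c : R) (y : σ → R) :
    MvPolynomial.eval (c • y) P = c ^ N * MvPolynomial.eval y P := by
  rw [MvPolynomial.eval_eq, MvPolynomial.eval_eq, Finset.mul_sum]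
  refine Finset.sum_congr rfl fun d hd => ?_
  have hd' : ∑ i ∈ d.support, d i = N := by
    have := hP (MvPolynomial.mem_support_iff.mp hd)
    simpa [Finsupp.weight_apply, Finsupp.sum] using this
  simp only [Pi.smul_apply, smul_eq_mul, mul_pow, Finset.prod_mul_distrib,
    Finset.prod_pow_eq_pow_sum, hd']
  ring

theorem homogeneousComponent_totalDegree_ne_zero {σ R : Type*} [CommSemiring R]
    {P : MvPolynomial σ R} (hP : P ≠ 0) :
    MvPolynomial.homogeneousComponent P.totalDegree P ≠ 0 := by
  obtain ⟨d, hd, hd'⟩ := Finset.exists_mem_eq_sup P.support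
    (MvPolynomial.support_nonempty.mpr hP) (fun s => s.sum fun _ e => e)
  intro h
  have h1 := congrArg (MvPolynomial.coeff d) h
  rw [MvPolynomial.coeff_homogeneousComponent, if_pos] at h1
  · exact MvPolynomial.mem_support_iff.mp hd h1
  · rw [MvPolynomial.totalDegree, hd']
    rfl

/-- If `P` vanishes along a sequence going to infinity with limit direction `v`, then its leading
form vanishes at `v`. -/
theorem eval_homogeneousComponent_eq_zero_of_tendsto {σ : Type*} (P : MvPolynomial σ ℂ)
    {y : ℕ → σ → ℂ} {s : ℕ → ℂ} {v : σ → ℂ} (hP : ∀ i, MvPolynomial.eval (y i) P = 0)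
    (hs : Tendsto s atTop (𝓝 0)) (hy : Tendsto (fun i => s i • y i) atTop (𝓝 v)) :
    MvPolynomial.eval v (MvPolynomial.homogeneousComponent P.totalDegree P) = 0 := by
  set N := P.totalDegree with hN
  have h1 : ∀ i, ∑ k ∈ Finset.range (N + 1), s i ^ (N - k) *
      MvPolynomial.eval (s i • y i) (MvPolynomial.homogeneousComponent k P) = 0 := by
    intro i
    rw [← mul_zero (s i ^ N), ← hP i]
    conv_rhs => rw [← MvPolynomial.sum_homogeneousComponent P, map_sum, Finset.mul_sum, ← hN]
    refine Finset.sum_congr rfl fun k hk => ?_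
    rw [eval_smul_of_isHomogeneous (MvPolynomial.homogeneousComponent_isHomogeneous k P),
      ← mul_assoc, ← pow_add, Nat.sub_add_cancel (Nat.lt_succ_iff.mp (Finset.mem_range.mp hk))]
  have h2 : Tendsto (fun i => ∑ k ∈ Finset.range (N + 1), s i ^ (N - k) *
      MvPolynomial.eval (s i • y i) (MvPolynomial.homogeneousComponent k P)) atTop
      (𝓝 (∑ k ∈ Finset.range (N + 1), 0 ^ (N - k) *
        MvPolynomial.eval v (MvPolynomial.homogeneousComponent k P))) :=
    tendsto_finsetSum _ fun k _ => (hs.pow _).mul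
      (((MvPolynomial.continuous_eval _).tendsto v).comp hy)
  simp only [h1] at h2
  have h3 := tendsto_nhds_unique h2 tendsto_const_nhds
  rw [Finset.sum_range_succ, Finset.sum_eq_zero] at h3
  · simpa using h3
  · intro k hk
    rw [zero_pow (Nat.sub_ne_zero_of_lt (Finset.mem_range.mp hk)), zero_mul]

theorem finite_setOf_eval_eq_zero {Q : MvPolynomial (Fin 2) ℂ} {N : ℕ} (hQ : Q.IsHomogeneous N)
    (hQ0 : Q ≠ 0) : {t : ℂ | MvPolynomial.eval ![1, t] Q = 0}.Finite := by
  let R : Polynomial ℂ := MvPolynomial.aeval ![1, Polynomial.X] Q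
  have hR : ∀ t, R.eval t = MvPolynomial.eval ![1, t] Q := by
    intro t
    have : (MvPolynomial.aeval ![1, t] Q : ℂ) = Polynomial.aeval t R := by
      rw [MvPolynomial.comp_aeval_apply]
      congr 2
      ext i
      fin_cases i <;> simp
    rw [← Polynomial.coe_aeval_eq_eval, ← this, MvPolynomial.aeval_eq_eval]
  have hR0 : R ≠ 0 := by
    intro h0
    have : MvPolynomial.X 0 * Q = 0 := by
      refine MvPolynomial.funext fun y => ?_
      rw [map_mul, MvPolynomial.eval_X, map_zero]
      by_cases hy : y 0 = 0
      · rw [hy, zero_mul]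
      · have h2 : y = y 0 • ![1, y 1 / y 0] := by
          ext i
          fin_cases i
          · simp
          · simp [mul_div_cancel₀ _ hy]
        rw [h2, eval_smul_of_isHomogeneous hQ, ← hR, h0]
        simp
    exact hQ0 ((mul_eq_zero.mp this).resolve_left (MvPolynomial.X_ne_zero 0))
  refine (R.roots.toFinset.finite_toSet).subset fun t ht => ?_
  have ht : MvPolynomial.eval ![1, t] Q = 0 := ht
  simp [hR0, Polynomial.IsRoot, hR, ht]

/-- The set of limit directions of `X` at infinity. -/
def directionsInf {E : Type*} [NormedAddCommGroup E] [NormedSpace ℝ E] (X : Set E) : Set E :=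
  {u | (u, (0 : ℝ)) ∈ strictTransformInf X}

theorem mem_directionsInf_iff {E : Type*} [NormedAddCommGroup E] [NormedSpace ℝ E] {X : Set E}
    {u : E} : u ∈ directionsInf X ↔ ∃ x : ℕ → E, (∀ i, x i ∈ X) ∧
      Tendsto (fun i => ‖x i‖) atTop atTop ∧ Tendsto (fun i => ‖x i‖⁻¹ • x i) atTop (𝓝 u) := by
  constructor
  · intro hu
    obtain ⟨z, hz, hzu⟩ := mem_closure_iff_seq_limit.mp hu
    choose x hx hxz using hz
    refine ⟨x, fun i => (hx i).1, ?_, ?_⟩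
    · have h1 : Tendsto (fun i => ‖x i‖⁻¹) atTop (𝓝 0) := by
        have := (continuous_snd.tendsto _).comp hzu
        refine this.congr fun i => ?_
        simp [← hxz, blowupInvInf]
      have h2 : Tendsto (fun i => ‖x i‖⁻¹) atTop (𝓝[>] 0) :=
        tendsto_nhdsWithin_iff.mpr ⟨h1, Eventually.of_forall fun i =>
          inv_pos.mpr (norm_pos_iff.mpr (hx i).2)⟩
      refine h2.inv_tendsto_nhdsGT_zero.congr fun i => ?_
      simp
    · have := (continuous_fst.tendsto _).comp hzu
      refine this.congr fun i => ?_
      simp [← hxz, blowupInvInf]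
  · rintro ⟨x, hx, hx1, hx2⟩
    refine mem_closure_of_tendsto (hx2.prodMk_nhds hx1.inv_tendsto_atTop) ?_
    filter_upwards [hx1.eventually_gt_atTop 0] with i hi
    exact ⟨x i, ⟨hx i, norm_pos_iff.mp hi⟩, rfl⟩

theorem norm_eq_one_of_mem_directionsInf {E : Type*} [NormedAddCommGroup E] [NormedSpace ℝ E]
    {X : Set E} {u : E} (hu : u ∈ directionsInf X) : ‖u‖ = 1 := by
  obtain ⟨x, hx, hx1, hx2⟩ := mem_directionsInf_iff.mp hu
  refine tendsto_nhds_unique hx2.norm (tendsto_const_nhds.congr' ?_)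
  filter_upwards [hx1.eventually_gt_atTop 0] with i hi
  rw [norm_smul, norm_inv, norm_norm, inv_mul_cancel₀ hi.ne']

theorem directionsInf_iUnion {E ι : Type*} [NormedAddCommGroup E] [NormedSpace ℝ E]
    {S : Set ι} (hS : S.Finite) (X : ι → Set E) :
    directionsInf (⋃ i ∈ S, X i) = ⋃ i ∈ S, directionsInf (X i) := by
  ext u
  simp only [directionsInf, strictTransformInf, iUnion_sdiff, image_iUnion, mem_ofPred_eq,
    hS.closure_biUnion, mem_iUnion, exists_prop]

theorem exists_relation_of_noPrimeChain {n : ℕ} {p : Ideal (MvPolynomial (Fin n) ℂ)} [p.IsPrime]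
    (hp : NoPrimeChain p) (i j : Fin n) : ∃ P : MvPolynomial (Fin 2) ℂ, P ≠ 0 ∧
      ∀ x ∈ algSet p, MvPolynomial.eval ![x i, x j] P = 0 := by
  by_contra! hcon
  let y : Fin 2 → MvPolynomial (Fin n) ℂ := ![MvPolynomial.X i, MvPolynomial.X j]
  have h : AlgebraicIndependent ℂ (fun a => Ideal.Quotient.mkₐ ℂ p (y a)) := by
    rw [algebraicIndependent_iff]
    intro P hP
    by_contra hP0
    obtain ⟨x, hx, hxP⟩ := hcon P hP0
    rw [← MvPolynomial.comp_aeval_apply] at hP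
    have h1 := hx _ (Ideal.Quotient.eq_zero_iff_mem.mp hP)
    refine hxP ?_
    rw [← MvPolynomial.aeval_eq_eval, MvPolynomial.comp_aeval_apply] at h1
    rw [← MvPolynomial.aeval_eq_eval, ← h1]
    congr 2
    ext a
    fin_cases a <;> simp [y]
  have h1 := h.lift_cardinalMk_le_trdeg.trans (Cardinal.lift_le.mpr (trdeg_quotient_le_one p hp))
  simp at h1

theorem exists_finite_directions_of_noPrimeChain {n : ℕ} {p : Ideal (MvPolynomial (Fin n) ℂ)}
    [p.IsPrime] (hp : NoPrimeChain p) : ∃ T : Set (EuclideanSpace ℂ (Fin n)), T.Finite ∧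
      (∀ v ∈ T, v ≠ 0) ∧ ∀ u ∈ directionsInf (algSet p), ∃ v ∈ T, ∃ c : ℂ, u = c • v := by
  choose P hP0 hP using fun i j => exists_relation_of_noPrimeChain hp i j
  let Q : Fin n → Fin n → MvPolynomial (Fin 2) ℂ := fun i j =>
    MvPolynomial.homogeneousComponent (P i j).totalDegree (P i j)
  have hQ : ∀ i j, (Q i j).IsHomogeneous (P i j).totalDegree := fun i j =>
    MvPolynomial.homogeneousComponent_isHomogeneous _ _
  refine ⟨⋃ i, {v | v i = 1 ∧ ∀ j, MvPolynomial.eval ![1, v j] (Q i j) = 0},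
    Set.finite_iUnion fun i => ?_, ?_, fun u hu => ?_⟩
  · have h := Set.Finite.pi' fun j => finite_setOf_eval_eq_zero (hQ i j)
      (homogeneousComponent_totalDegree_ne_zero (hP0 i j))
    refine (h.preimage (f := fun v : EuclideanSpace ℂ (Fin n) => v.ofLp)
      (WithLp.ofLp_injective 2).injOn).subset fun v hv => hv.2
  · rintro v hv rfl
    obtain ⟨i, hi, -⟩ := mem_iUnion.mp hv
    simp at hi
  · have hu0 : u ≠ 0 := norm_ne_zero_iff.mp (by simp [norm_eq_one_of_mem_directionsInf hu])
    obtain ⟨i, hi⟩ : ∃ i, u i ≠ 0 := by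
      by_contra! h
      exact hu0 (by ext i; simpa using h i)
    obtain ⟨x, hx, hx1, hx2⟩ := mem_directionsInf_iff.mp hu
    refine ⟨(u i)⁻¹ • u, mem_iUnion.mpr ⟨i, by simp [hi], fun j => ?_⟩, u i, by simp [smul_smul, hi]⟩
    have h1 : MvPolynomial.eval ![u i, u j] (Q i j) = 0 := by
      refine eval_homogeneousComponent_eq_zero_of_tendsto (P i j) (fun a => hP i j (x a) (hx a))
        (s := fun a => ((‖x a‖⁻¹ : ℝ) : ℂ)) ?_ ?_
      · have := (Complex.continuous_ofReal.tendsto 0).comp hx1.inv_tendsto_atTop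
        simpa [Function.comp_def] using this
      · rw [tendsto_pi_nhds]
        have key : ∀ b, Tendsto (fun a => ((‖x a‖⁻¹ : ℝ) : ℂ) • x a b) atTop (𝓝 (u b)) := by
          intro b
          have := ((EuclideanSpace.proj (𝕜 := ℂ) b).continuous.tendsto u).comp hx2
          refine this.congr fun a => ?_
          simp
        intro b
        fin_cases b
        · exact key i
        · exact key j
    have h2 : ![u i, u j] = u i • ![1, ((u i)⁻¹ • u) j] := by
      ext b
      fin_cases b
      · simp
      · simp [hi]
    rw [h2, eval_smul_of_isHomogeneous (hQ i j)] at h1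
    exact (mul_eq_zero.mp h1).resolve_left (pow_ne_zero _ hi)

theorem exists_subseq_tendsto_directionsInf {E : Type*} [NormedAddCommGroup E] [NormedSpace ℝ E]
    [ProperSpace E] {X : Set E} {x : ℕ → E} (hx : ∀ i, x i ∈ X)
    (hx' : Tendsto (fun i => ‖x i‖) atTop atTop) :
    ∃ u ∈ directionsInf X, ∃ φ : ℕ → ℕ, StrictMono φ ∧
      Tendsto (fun i => ‖x (φ i)‖⁻¹ • x (φ i)) atTop (𝓝 u) := by
  obtain ⟨u, -, φ, hφ, hu⟩ := (isCompact_closedBall (0 : E) 1).tendsto_subseq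
    (x := fun i => ‖x i‖⁻¹ • x i) (fun i => by
      rw [mem_closedBall_zero_iff, norm_smul, norm_inv, norm_norm]
      exact inv_mul_le_one)
  exact ⟨u, mem_directionsInf_iff.mpr
    ⟨x ∘ φ, fun i => hx _, hx'.comp hφ.tendsto_atTop, hu⟩, φ, hφ, hu⟩

theorem exists_norm_le_mul_max {n : ℕ} {X : Set (EuclideanSpace ℂ (Fin n))}
    (ℓ : EuclideanSpace ℂ (Fin n) →L[ℂ] ℂ) (hℓ : ∀ u ∈ directionsInf X, ℓ u ≠ 0) :
    ∃ M : ℝ, ∀ x ∈ X, ‖x‖ ≤ M * max 1 ‖ℓ x‖ := by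
  by_contra! hcon
  choose x hx hxn using fun i : ℕ => hcon i
  have hxi : ∀ i : ℕ, (i : ℝ) ≤ ‖x i‖ := fun i =>
    (le_mul_of_one_le_right (Nat.cast_nonneg i) (le_max_left _ _)).trans (hxn i).le
  have hx' : Tendsto (fun i => ‖x i‖) atTop atTop :=
    tendsto_atTop_mono hxi tendsto_natCast_atTop_atTop
  obtain ⟨u, hu, φ, hφ, hxu⟩ := exists_subseq_tendsto_directionsInf hx hx'
  refine hℓ u hu (tendsto_nhds_unique ((ℓ.continuous.tendsto u).comp hxu) ?_)
  refine squeeze_zero_norm' (a := fun i => ((φ i : ℕ) : ℝ)⁻¹) ?_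
    (tendsto_inv_atTop_zero.comp (tendsto_natCast_atTop_atTop.comp hφ.tendsto_atTop))
  filter_upwards [(hx'.comp hφ.tendsto_atTop).eventually_gt_atTop 0,
    (tendsto_natCast_atTop_atTop (R := ℝ).comp hφ.tendsto_atTop).eventually_gt_atTop 0] with i hi hi'
  simp only [Function.comp_apply] at hi hi' ⊢
  rw [ContinuousLinearMap.map_smul_of_tower, norm_smul, norm_inv, norm_norm, inv_mul_le_iff₀ hi,
    ← div_eq_mul_inv, le_div_iff₀ hi', mul_comm]
  exact (mul_le_mul_of_nonneg_left (le_max_right _ _) hi'.le).trans (hxn (φ i)).le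

theorem tendsto_norm_eval_div_pow {P : Polynomial ℂ} {z : ℕ → ℂ}
    (hz : Tendsto (fun i => ‖z i‖) atTop atTop) :
    Tendsto (fun i => ‖P.eval (z i)‖ / ‖z i‖ ^ P.natDegree) atTop (𝓝 ‖P.leadingCoeff‖) := by
  have h0 : Tendsto (fun i => (z i)⁻¹) atTop (𝓝 0) := by
    rw [tendsto_zero_iff_norm_tendsto_zero]
    simpa [Function.comp_def] using tendsto_inv_atTop_zero.comp hz
  have h1 := ((P.reverse.continuous.tendsto 0).comp h0).norm
  rw [← Polynomial.coeff_zero_eq_eval_zero, Polynomial.coeff_zero_reverse] at h1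
  refine h1.congr' ?_
  filter_upwards [hz.eventually_gt_atTop 0] with i hi
  have hi' : z i ≠ 0 := norm_pos_iff.mp hi
  let _ : Invertible (z i) := invertibleOfNonzero hi'
  have := Polynomial.eval₂_reverse_mul_pow (RingHom.id ℂ) (z i) P
  rw [eq_div_iff (pow_pos hi _).ne', ← norm_pow, ← norm_mul]
  simpa [Polynomial.eval₂_id] using congrArg norm this

theorem tendsto_norm_eval_mul_div {P : Polynomial ℂ} (hP : P ≠ 0) {z : ℕ → ℂ} {c : ℂ}
    (hz : Tendsto (fun i => ‖z i‖) atTop atTop) (hc : ‖c‖ = 1) :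
    Tendsto (fun i => ‖P.eval (c * z i)‖ / ‖P.eval (z i)‖) atTop (𝓝 1) := by
  have h1 := tendsto_norm_eval_div_pow (P := P) (z := fun i => c * z i)
    (by simpa [norm_mul, hc] using hz)
  have h2 := tendsto_norm_eval_div_pow (P := P) hz
  have hl : ‖P.leadingCoeff‖ ≠ 0 := norm_ne_zero_iff.mpr (Polynomial.leadingCoeff_ne_zero.mpr hP)
  have h3 := h1.div h2 hl
  rw [div_self hl] at h3
  refine h3.congr' ?_
  filter_upwards [hz.eventually_gt_atTop 0] with i hi
  simp only [Pi.div_apply, norm_mul, hc, one_mul]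
  exact div_div_div_cancel_right₀ (pow_pos hi _).ne' _ _

theorem eventually_eval_ne_zero {P : Polynomial ℂ} (hP : P ≠ 0) {z : ℕ → ℂ}
    (hz : Tendsto (fun i => ‖z i‖) atTop atTop) : ∀ᶠ i in atTop, P.eval (z i) ≠ 0 := by
  have hl : ‖P.leadingCoeff‖ ≠ 0 := norm_ne_zero_iff.mpr (Polynomial.leadingCoeff_ne_zero.mpr hP)
  filter_upwards [(tendsto_norm_eval_div_pow hz).eventually_ne hl] with i hi h0
  simp [h0] at hi

theorem norm_multiset_prod_le_pow_card {s : Multiset ℂ} {b : ℝ} (hs : ∀ z ∈ s, ‖z‖ ≤ b) :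
    ‖s.prod‖ ≤ b ^ s.card := by
  induction s using Multiset.induction_on with
  | empty => simp
  | cons a s ih =>
    rw [Multiset.prod_cons, Multiset.card_cons, norm_mul, pow_succ']
    have ha := hs a (Multiset.mem_cons_self a s)
    exact mul_le_mul ha (ih fun z hz => hs z (Multiset.mem_cons_of_mem hz)) (norm_nonneg _)
      ((norm_nonneg _).trans ha)

theorem le_norm_multiset_prod {s : Multiset ℂ} {b : ℝ} (hb : 0 ≤ b) (hs : ∀ z ∈ s, b ≤ ‖z‖) :
    b ^ s.card ≤ ‖s.prod‖ := by
  induction s using Multiset.induction_on with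
  | empty => simp
  | cons a s ih =>
    rw [Multiset.prod_cons, Multiset.card_cons, norm_mul, pow_succ']
    exact mul_le_mul (hs a (Multiset.mem_cons_self a s))
      (ih fun z hz => hs z (Multiset.mem_cons_of_mem hz)) (pow_nonneg hb _) (norm_nonneg _)

theorem norm_coeff_zero_eq {Q : Polynomial ℂ} (hQ : Q.Monic) : ‖Q.coeff 0‖ = ‖Q.roots.prod‖ := by
  rw [(IsAlgClosed.splits Q).coeff_zero_eq_prod_roots_of_monic hQ]
  simp

theorem card_roots_eq {Q : Polynomial ℂ} : Q.roots.card = Q.natDegree :=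
  (IsAlgClosed.splits Q).natDegree_eq_card_roots.symm

theorem norm_coeff_zero_le {Q : Polynomial ℂ} (hQ : Q.Monic) {b : ℝ} {r : ℂ} (hr : Q.eval r = 0)
    (hb : ∀ z, Q.eval z = 0 → ‖z‖ ≤ b) : ‖Q.coeff 0‖ ≤ ‖r‖ * b ^ (Q.natDegree - 1) := by
  have hr' : r ∈ Q.roots := (Polynomial.mem_roots hQ.ne_zero).mpr hr
  obtain ⟨s, hs⟩ := Multiset.exists_cons_of_mem hr'
  rw [norm_coeff_zero_eq hQ, ← card_roots_eq, hs, Multiset.prod_cons, norm_mul,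
    Multiset.card_cons, Nat.add_sub_cancel]
  refine mul_le_mul_of_nonneg_left (norm_multiset_prod_le_pow_card fun z hz => hb z ?_) (norm_nonneg _)
  exact (Polynomial.mem_roots hQ.ne_zero).mp (hs ▸ Multiset.mem_cons_of_mem hz)

theorem exists_root_norm_pow_le {Q : Polynomial ℂ} (hQ : Q.Monic) (hd : Q.natDegree ≠ 0) :
    ∃ r, Q.eval r = 0 ∧ ‖r‖ ^ Q.natDegree ≤ ‖Q.coeff 0‖ := by
  have hne : Q.roots.toFinset.Nonempty := by
    rw [Multiset.toFinset_nonempty, ← Multiset.card_pos, card_roots_eq]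
    exact Nat.pos_of_ne_zero hd
  obtain ⟨r, hr, hmin⟩ := Q.roots.toFinset.exists_min_image (fun z => ‖z‖) hne
  refine ⟨r, (Polynomial.mem_roots hQ.ne_zero).mp (Multiset.mem_toFinset.mp hr), ?_⟩
  rw [norm_coeff_zero_eq hQ, ← card_roots_eq]
  exact le_norm_multiset_prod (norm_nonneg _) fun z hz => hmin z (Multiset.mem_toFinset.mpr hz)

theorem exists_mvPolynomial_eval_eq {n : ℕ} (ℓ : EuclideanSpace ℂ (Fin n) →L[ℂ] ℂ) :
    ∃ L : MvPolynomial (Fin n) ℂ, ∀ x : EuclideanSpace ℂ (Fin n),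
      MvPolynomial.eval (fun j => x j) L = ℓ x := by
  refine ⟨∑ j, MvPolynomial.C (ℓ (EuclideanSpace.single j 1)) * MvPolynomial.X j, fun x => ?_⟩
  have hx : x = ∑ j, x j • EuclideanSpace.single j (1 : ℂ) := by
    ext i
    simp [Pi.single_apply]
  conv_rhs => rw [hx]
  simp [mul_comm]

theorem tendsto_zero_of_pow {a : ℕ → ℝ} {d : ℕ} (ha : ∀ i, 0 ≤ a i)
    (h : Tendsto (fun i => a i ^ d) atTop (𝓝 0)) : Tendsto a atTop (𝓝 0) := by
  rw [Metric.tendsto_atTop']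
  intro ε hε
  obtain ⟨N, hN⟩ := eventually_atTop.mp (h.eventually_lt_const (pow_pos hε d))
  refine ⟨N, fun i hi => ?_⟩
  rw [Real.dist_0_eq_abs, abs_of_nonneg (ha i)]
  exact lt_of_pow_lt_pow_left₀ d hε.le (hN i hi.le)

theorem exists_lift_of_integral_relation {α : Type*} {A : Set α} {ℓ w : α → ℂ} {f : Polynomial ℂ}
    {q : Polynomial (Polynomial ℂ)} (hf : f ≠ 0) (hq : q.Monic)
    (hroot : ∀ x ∈ A, q.evalEval (ℓ x) (f.eval (ℓ x) * w x) = 0)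
    (hlift : ∀ s t, f.eval s ≠ 0 → q.evalEval s (f.eval s * t) = 0 → ∃ x ∈ A, ℓ x = s ∧ w x = t)
    {M : ℝ} (hM : ∀ x ∈ A, ‖w x‖ ≤ M * max 1 ‖ℓ x‖) {x : ℕ → α} (hx : ∀ i, x i ∈ A)
    (hℓ : Tendsto (fun i => ‖ℓ (x i)‖) atTop atTop)
    (hw : Tendsto (fun i => ‖w (x i)‖ / ‖ℓ (x i)‖) atTop (𝓝 0)) {c : ℂ} (hc : ‖c‖ = 1) :
    ∃ y : ℕ → α, (∀ i, y i ∈ A) ∧ (∀ᶠ i in atTop, ℓ (y i) = c * ℓ (x i)) ∧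
      Tendsto (fun i => ‖w (y i)‖ / ‖ℓ (x i)‖) atTop (𝓝 0) := by
  set z : ℕ → ℂ := fun i => ℓ (x i) with hz
  have hcz : Tendsto (fun i => ‖c * z i‖) atTop atTop := by simpa [norm_mul, hc] using hℓ
  set d := q.natDegree with hd
  let Q : ℂ → Polynomial ℂ := fun s => q.map (Polynomial.evalRingHom s)
  have hQm : ∀ s, (Q s).Monic := fun s => hq.map _
  have hQd : ∀ s, (Q s).natDegree = d := fun s => hq.natDegree_map _
  have hQe : ∀ s t, (Q s).eval t = q.evalEval s t := fun s t => Polynomial.map_evalRingHom_eval s t q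
  have hQ0 : ∀ s, (Q s).coeff 0 = (q.coeff 0).eval s := fun s => by simp [Q]
  have hd0 : d ≠ 0 := fun h0 => by
    have := hroot (x 0) (hx 0)
    rw [Polynomial.eq_one_of_monic_natDegree_zero hq h0] at this
    simp at this
  let g : ℂ → ℝ := fun s => ‖(q.coeff 0).eval s‖ / (‖f.eval s‖ * ‖s‖) ^ d
  have hg : Tendsto (fun i => g (z i)) atTop (𝓝 0) := by
    have h0 : Tendsto (fun i => M ^ (d - 1) * (‖w (x i)‖ / ‖z i‖)) atTop (𝓝 0) := by
      simpa using hw.const_mul (M ^ (d - 1))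
    refine squeeze_zero' (Eventually.of_forall fun i => by positivity) ?_ h0
    filter_upwards [hℓ.eventually_ge_atTop 1, eventually_eval_ne_zero hf hℓ] with i hi hfi
    have hfi : f.eval (z i) ≠ 0 := hfi
    have hi : 1 ≤ ‖z i‖ := hi
    have hf' : 0 < ‖f.eval (z i)‖ := norm_pos_iff.mpr hfi
    have hz' : 0 < ‖z i‖ := by linarith
    have h1 := norm_coeff_zero_le (hQm (z i)) (r := f.eval (z i) * w (x i))
      (b := ‖f.eval (z i)‖ * (M * ‖z i‖)) ((hQe _ _).trans (hroot _ (hx i))) fun t ht => by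
        obtain ⟨y, hy, hy1, hy2⟩ := hlift (z i) (t / f.eval (z i)) hfi
          (by rwa [mul_div_cancel₀ _ hfi, ← hQe])
        have := hM y hy
        rw [hy1, hy2, max_eq_right hi, norm_div, div_le_iff₀ hf'] at this
        linarith
    rw [hQ0, hQd, norm_mul] at h1
    have h2 : (‖f.eval (z i)‖ * ‖z i‖) ^ d =
        (‖f.eval (z i)‖ * ‖z i‖) ^ (d - 1) * (‖f.eval (z i)‖ * ‖z i‖) := by
      rw [← pow_succ, Nat.sub_add_cancel (Nat.pos_of_ne_zero hd0)]
    rw [div_le_iff₀ (by positivity), h2]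
    refine h1.trans (le_of_eq ?_)
    rw [mul_pow, mul_pow, mul_pow]
    field_simp
  have hg' : Tendsto (fun i => g (c * z i)) atTop (𝓝 0) := by
    by_cases hq0 : q.coeff 0 = 0
    · simp [g, hq0]
    · have h1 := ((tendsto_norm_eval_mul_div hq0 hℓ hc).mul
        (((tendsto_norm_eval_mul_div hf hℓ hc).inv₀ one_ne_zero).pow d)).mul hg
      rw [mul_zero] at h1
      refine h1.congr' ?_
      filter_upwards [eventually_eval_ne_zero hq0 hℓ, eventually_eval_ne_zero hf hℓ] with i h1 h2
      have h1 : ‖(q.coeff 0).eval (z i)‖ ≠ 0 := norm_ne_zero_iff.mpr h1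
      have h2 : ‖f.eval (z i)‖ ≠ 0 := norm_ne_zero_iff.mpr h2
      change ‖(q.coeff 0).eval (c * z i)‖ / ‖(q.coeff 0).eval (z i)‖ *
        (‖f.eval (c * z i)‖ / ‖f.eval (z i)‖)⁻¹ ^ d * g (z i) = g (c * z i)
      simp only [g, norm_mul, hc, one_mul, mul_pow, inv_div, div_pow]
      field_simp
  have hex : ∀ i, ∃ y ∈ A, 0 < ‖z i‖ → f.eval (c * z i) ≠ 0 →
      ℓ y = c * z i ∧ (‖w y‖ / ‖z i‖) ^ d ≤ g (c * z i) := by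
    intro i
    by_cases hfi : f.eval (c * z i) = 0
    · exact ⟨x i, hx i, fun _ h => absurd hfi h⟩
    obtain ⟨r, hr, hrd⟩ := exists_root_norm_pow_le (hQm (c * z i)) ((hQd _).trans_ne hd0)
    obtain ⟨y, hy, hy1, hy2⟩ := hlift (c * z i) (r / f.eval (c * z i)) hfi
      (by rwa [mul_div_cancel₀ _ hfi, ← hQe])
    refine ⟨y, hy, fun hzi _ => ⟨hy1, ?_⟩⟩
    rw [hQ0, hQd] at hrd
    have hf' : 0 < ‖f.eval (c * z i)‖ := norm_pos_iff.mpr hfi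
    rw [hy2, norm_div, div_div, div_pow]
    simp only [g, norm_mul, hc, one_mul]
    exact div_le_div_of_nonneg_right hrd (by positivity)
  choose y hyA hy using hex
  have hev : ∀ᶠ i in atTop, ℓ (y i) = c * z i ∧ (‖w (y i)‖ / ‖z i‖) ^ d ≤ g (c * z i) := by
    filter_upwards [hℓ.eventually_gt_atTop 0, eventually_eval_ne_zero hf hcz] with i h1 h2
    exact hy i h1 h2
  refine ⟨y, hyA, hev.mono fun i hi => hi.1, tendsto_zero_of_pow (d := d)
    (fun i => by positivity) (squeeze_zero' (Eventually.of_forall fun i => by positivity)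
      (hev.mono fun i hi => hi.2) hg')⟩

theorem exists_separating_functionals {n : ℕ} {D : Set (EuclideanSpace ℂ (Fin n))}
    {T : Set (EuclideanSpace ℂ (Fin n))} (hT : T.Finite) (hT0 : ∀ v ∈ T, v ≠ 0)
    (hD0 : ∀ v ∈ D, v ≠ 0) (hD : ∀ v ∈ D, ∃ t ∈ T, ∃ c : ℂ, v = c • t)
    {u : EuclideanSpace ℂ (Fin n)} (hu : u ∈ D) :
    ∃ ℓ w : EuclideanSpace ℂ (Fin n) →L[ℂ] ℂ, (∀ v ∈ D, ℓ v ≠ 0) ∧ w u = 0 ∧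
      ∀ v ∈ D, w v = 0 → ∃ c : ℂ, v = c • u := by
  have hdual : ∀ S : Set (EuclideanSpace ℂ (Fin n)), S.Finite →
      ∃ ℓ : EuclideanSpace ℂ (Fin n) →L[ℂ] ℂ, ∀ v ∈ S, v ≠ 0 → ℓ v ≠ 0 := by
    intro S hS
    have : Finite ↥(S \ {0}) := hS.sdiff
    obtain ⟨ℓ, hℓ⟩ := Module.exists_dual_forall_apply_ne_zero (K := ℂ)
      (fun v : ↥(S \ {0}) => (v : EuclideanSpace ℂ (Fin n))) fun v => v.2.2
    exact ⟨LinearMap.toContinuousLinearMap ℓ, fun v hv hv0 => hℓ ⟨v, hv, hv0⟩⟩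
  obtain ⟨ℓ, hℓ⟩ := hdual T hT
  have hℓD : ∀ v ∈ D, ℓ v ≠ 0 := by
    intro v hv
    obtain ⟨t, ht, c, rfl⟩ := hD v hv
    rw [map_smul, smul_eq_mul]
    exact mul_ne_zero (fun hc => hD0 _ hv (by simp [hc])) (hℓ t ht (hT0 t ht))
  let π : EuclideanSpace ℂ (Fin n) → EuclideanSpace ℂ (Fin n) := fun v => v - (ℓ v / ℓ u) • u
  obtain ⟨w, hw⟩ := hdual (π '' T) (hT.image π)
  have key : ∀ v, (w - (w u / ℓ u) • ℓ) v = w (π v) := fun v => by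
    simp only [π, map_sub, map_smul, sub_apply, smul_apply,
      smul_eq_mul]
    ring
  refine ⟨ℓ, w - (w u / ℓ u) • ℓ, hℓD, ?_, fun v hv hv0 => ?_⟩
  · rw [key]
    simp [π, div_self (hℓD u hu)]
  · obtain ⟨t, ht, c, rfl⟩ := hD v hv
    have hc : c ≠ 0 := fun hc => hD0 _ hv (by simp [hc])
    rw [map_smul, smul_eq_mul, key] at hv0
    have h0 : π t = 0 := by
      by_contra h
      exact hw _ (mem_image_of_mem π ht) h ((mul_eq_zero.mp hv0).resolve_left hc)
    refine ⟨c * (ℓ t / ℓ u), ?_⟩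
    rw [← smul_smul, ← sub_eq_zero.mp h0]

theorem smul_mem_directionsInf_algSet {n : ℕ} {p : Ideal (MvPolynomial (Fin n) ℂ)} [p.IsPrime]
    (hp : NoPrimeChain p) {u : EuclideanSpace ℂ (Fin n)} (hu : u ∈ directionsInf (algSet p))
    {c : ℂ} (hc : ‖c‖ = 1) : c • u ∈ directionsInf (algSet p) := by
  obtain ⟨T, hT, hT0, hTD⟩ := exists_finite_directions_of_noPrimeChain hp
  have hD0 : ∀ v ∈ directionsInf (algSet p), v ≠ 0 := fun v hv =>
    norm_ne_zero_iff.mp (by simp [norm_eq_one_of_mem_directionsInf hv])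
  obtain ⟨ℓ, w, hℓ, hwu, hw⟩ := exists_separating_functionals hT hT0 hD0 hTD hu
  obtain ⟨L, hL⟩ := exists_mvPolynomial_eval_eq ℓ
  obtain ⟨W, hW⟩ := exists_mvPolynomial_eval_eq w
  obtain ⟨x, hx, hx1, hx2⟩ := mem_directionsInf_iff.mp hu
  have hnorm : ∀ (f : EuclideanSpace ℂ (Fin n) →L[ℂ] ℂ) y, f (‖y‖⁻¹ • y) = ‖y‖⁻¹ • f y :=
    fun f y => ContinuousLinearMap.map_smul_of_tower f _ _
  have hℓx : Tendsto (fun i => ‖x i‖⁻¹ • ℓ (x i)) atTop (𝓝 (ℓ u)) := by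
    simpa only [Function.comp_def, hnorm] using (ℓ.continuous.tendsto u).comp hx2
  have hwx : Tendsto (fun i => ‖x i‖⁻¹ • w (x i)) atTop (𝓝 0) := by
    simpa only [Function.comp_def, hnorm, hwu] using (w.continuous.tendsto u).comp hx2
  have hℓx1 : Tendsto (fun i => ‖ℓ (x i)‖) atTop atTop := by
    have h := hx1.atTop_mul_pos (norm_pos_iff.mpr (hℓ u hu)) hℓx.norm
    refine h.congr' ?_
    filter_upwards [hx1.eventually_gt_atTop 0] with i hi
    rw [norm_smul, norm_inv, norm_norm, mul_inv_cancel_left₀ hi.ne']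
  have hwℓ : Tendsto (fun i => ‖w (x i)‖ / ‖ℓ (x i)‖) atTop (𝓝 0) := by
    have h := hwx.norm.div hℓx.norm (norm_ne_zero_iff.mpr (hℓ u hu))
    rw [norm_zero, zero_div] at h
    refine h.congr' ?_
    filter_upwards [hx1.eventually_gt_atTop 0] with i hi
    simp only [Pi.div_apply, norm_smul, norm_inv, norm_norm]
    exact mul_div_mul_left _ _ (inv_pos.mpr hi).ne'
  obtain ⟨f, q, hf, hq, hroot, hlift⟩ := exists_integral_relation p hp L W (fun g hg => by
    by_contra hg0
    obtain ⟨i, hi⟩ := (eventually_eval_ne_zero hg0 hℓx1).exists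
    refine hi ?_
    have := hx i _ hg
    rw [← MvPolynomial.coe_aeval_eq_eval, RingHom.coe_coe, ← Polynomial.aeval_algHom_apply,
      MvPolynomial.aeval_eq_eval, hL, Polynomial.coe_aeval_eq_eval] at this
    exact this)
  obtain ⟨M, hM⟩ := exists_norm_le_mul_max ℓ hℓ
  obtain ⟨y, hy, hyℓ, hyw⟩ := exists_lift_of_integral_relation (A := algSet p) (ℓ := ℓ) (w := w)
    hf hq (fun x hx => by
      have := hroot _ (mem_zeroLocus_iff_mem_algSet.mpr hx)
      rwa [hL, hW] at this)
    (fun s t hs hst => by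
      obtain ⟨x, hx, hx1, hx2⟩ := hlift s t hs hst
      refine ⟨WithLp.toLp 2 x, mem_zeroLocus_iff_mem_algSet.mp hx, ?_, ?_⟩
      · rw [← hL, ← hx1]
      · rw [← hW, ← hx2])
    (M := ‖w‖ * M) (fun x hx => by
      rw [mul_assoc]
      exact (w.le_opNorm x).trans (mul_le_mul_of_nonneg_left (hM x hx) (norm_nonneg w)))
    hx hℓx1 hwℓ hc
  have hle : ∀ᶠ i in atTop, ‖ℓ (x i)‖ ≤ ‖ℓ‖ * ‖y i‖ := by
    filter_upwards [hyℓ] with i hi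
    have := ℓ.le_opNorm (y i)
    rwa [hi, norm_mul, hc, one_mul] at this
  have hℓ0 : 0 < ‖ℓ‖ := norm_pos_iff.mpr fun h => hℓ u hu (by simp [h])
  have hy1 : Tendsto (fun i => ‖y i‖) atTop atTop :=
    (tendsto_const_mul_atTop_of_pos hℓ0).mp (tendsto_atTop_mono' _ hle hℓx1)
  obtain ⟨v, hv, φ, hφ, hyv⟩ := exists_subseq_tendsto_directionsInf hy hy1
  have hφ' := hφ.tendsto_atTop
  have hwv : w v = 0 := by
    refine tendsto_nhds_unique ((w.continuous.tendsto v).comp hyv) ?_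
    refine squeeze_zero_norm' (a := fun i => ‖ℓ‖ * (‖w (y (φ i))‖ / ‖ℓ (x (φ i))‖)) ?_
      (by simpa using (hyw.comp hφ').const_mul ‖ℓ‖)
    filter_upwards [hφ'.eventually hle, (hy1.comp hφ').eventually_gt_atTop 0,
      (hℓx1.comp hφ').eventually_gt_atTop 0] with i h1 h2 h3
    simp only [Function.comp_apply, hnorm, norm_smul, norm_inv, norm_norm] at h2 h3 ⊢
    rw [inv_mul_le_iff₀ h2, mul_div_assoc', mul_div_assoc', le_div_iff₀ h3]
    nlinarith [mul_le_mul_of_nonneg_left h1 (norm_nonneg (w (y (φ i))))]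
  obtain ⟨a, rfl⟩ := hw v hv hwv
  have ha : Tendsto (fun i => ((‖x (φ i)‖ / ‖y (φ i)‖ : ℝ) : ℂ)) atTop (𝓝 (a / c)) := by
    have h1 := ((ℓ.continuous.tendsto _).comp hyv).div (hℓx.comp hφ') (hℓ u hu)
    rw [map_smul, smul_eq_mul, mul_div_cancel_right₀ _ (hℓ u hu)] at h1
    refine (h1.div_const c).congr' ?_
    filter_upwards [hφ'.eventually hyℓ, (hy1.comp hφ').eventually_gt_atTop 0,
      (hℓx1.comp hφ').eventually_gt_atTop 0, (hx1.comp hφ').eventually_gt_atTop 0] with i h1 h2 h3 h4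
    have hc0 : c ≠ 0 := norm_ne_zero_iff.mp (by simp [hc])
    have h2' : ((‖y (φ i)‖ : ℝ) : ℂ) ≠ 0 := Complex.ofReal_ne_zero.mpr h2.ne'
    have h4' : ((‖x (φ i)‖ : ℝ) : ℂ) ≠ 0 := Complex.ofReal_ne_zero.mpr h4.ne'
    have h3' : ℓ (x (φ i)) ≠ 0 := norm_pos_iff.mp h3
    simp only [Pi.div_apply, Function.comp_apply, hnorm, h1, Complex.real_smul,
      Complex.ofReal_inv, Complex.ofReal_div]
    field_simp
  have ha1 : ‖a / c‖ = 1 := by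
    have h1 := norm_eq_one_of_mem_directionsInf hv
    rw [norm_smul, norm_eq_one_of_mem_directionsInf hu, mul_one] at h1
    rw [norm_div, h1, hc, div_one]
  have ha2 : a / c = 1 := by
    have h1 := (Complex.continuous_ofReal.tendsto _).comp ha.norm
    have h2 : (fun i => ((‖x (φ i)‖ / ‖y (φ i)‖ : ℝ) : ℂ)) = Complex.ofReal ∘
        fun i => ‖((‖x (φ i)‖ / ‖y (φ i)‖ : ℝ) : ℂ)‖ := by
      ext i
      rw [Function.comp_apply, Complex.norm_of_nonneg (by positivity)]
    rw [← h2] at h1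
    rw [tendsto_nhds_unique ha h1, ha1, Complex.ofReal_one]
  have hc0 : c ≠ 0 := norm_ne_zero_iff.mp (by simp [hc])
  rwa [(div_eq_one_iff_eq hc0).mp ha2] at hv

section Projective

theorem continuous_projectivization_mk {K V α : Type*} [DivisionRing K] [AddCommGroup V] [Module K V]
    [TopologicalSpace V] [TopologicalSpace α] {f : α → V} (hf : Continuous f) (h0 : ∀ a, f a ≠ 0) :
    Continuous fun a => Projectivization.mk K (f a) (h0 a) :=
  (continuous_quotient_mk' (s := projectivizationSetoid K V)).comp (hf.subtype_mk h0)

/-- The orthogonal projection matrix onto a complex line. -/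
def projMatrix {ι : Type*} [Fintype ι] : Projectivization ℂ (ι → ℂ) → ι → ι → ℂ :=
  Projectivization.lift
    (fun v i j => v.1 i * star (v.1 j) / ∑ l, v.1 l * star (v.1 l)) (by
      intro v w t h
      have ht : t ≠ 0 := fun ht => v.2 (by simp [h, ht])
      have ht' : star t ≠ 0 := star_ne_zero.mpr ht
      ext i j
      have hs : ∑ l, v.1 l * star (v.1 l) = t * star t * ∑ l, w.1 l * star (w.1 l) := by
        rw [Finset.mul_sum]
        refine Finset.sum_congr rfl fun l _ => ?_
        rw [h, Pi.smul_apply, smul_eq_mul, star_mul']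
        ring
      rw [hs, h, Pi.smul_apply, Pi.smul_apply, smul_eq_mul, smul_eq_mul, star_mul',
        ← mul_div_mul_left (w.1 i * star (w.1 j)) _ (mul_ne_zero ht ht')]
      congr 1
      ring)

theorem sum_mul_star_ne_zero {ι : Type*} [Fintype ι] {v : ι → ℂ} (hv : v ≠ 0) :
    ∑ l, v l * star (v l) ≠ 0 := fun h => hv (by
  open ComplexOrder in exact dotProduct_self_star_eq_zero.mp h)

theorem continuous_projMatrix {ι : Type*} [Fintype ι] :
    Continuous (projMatrix : Projectivization ℂ (ι → ℂ) → ι → ι → ℂ) := by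
  refine continuous_quot_lift _ ?_
  refine continuous_pi fun i => continuous_pi fun j => Continuous.div ?_ ?_
    fun v => sum_mul_star_ne_zero v.2
  · exact ((continuous_apply i).comp continuous_subtype_val).mul
      ((continuous_apply j).comp continuous_subtype_val).star
  · exact continuous_finsetSum _ fun l _ => ((continuous_apply l).comp continuous_subtype_val).mul
      ((continuous_apply l).comp continuous_subtype_val).star

theorem projMatrix_injective {ι : Type*} [Fintype ι] :
    Function.Injective (projMatrix : Projectivization ℂ (ι → ℂ) → ι → ι → ℂ) := by
  intro a b
  induction a using Projectivization.ind with | _ v hv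
  induction b using Projectivization.ind with | _ w hw
  intro h
  obtain ⟨j, hj⟩ := Function.ne_iff.mp hv
  have hv' := sum_mul_star_ne_zero hv
  have hw' := sum_mul_star_ne_zero hw
  have hj' : star (v j) ≠ 0 := star_ne_zero.mpr hj
  refine (Projectivization.mk_eq_mk_iff' ℂ v w hv hw).mpr
    ⟨(∑ l, v l * star (v l)) / star (v j) * (star (w j) / ∑ l, w l * star (w l)), ?_⟩
  ext i
  have hij : v i * star (v j) / ∑ l, v l * star (v l) =
      w i * star (w j) / ∑ l, w l * star (w l) := congrFun (congrFun h i) j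
  rw [Pi.smul_apply, smul_eq_mul]
  have h1 : (∑ l, v l * star (v l)) / star (v j) * (star (w j) / ∑ l, w l * star (w l)) * w i =
      (∑ l, v l * star (v l)) / star (v j) * (w i * star (w j) / ∑ l, w l * star (w l)) := by ring
  rw [h1, ← hij]
  field_simp

instance {ι : Type*} [Fintype ι] : T2Space (Projectivization ℂ (ι → ℂ)) :=
  T2Space.of_injective_continuous projMatrix_injective continuous_projMatrix

variable {n : ℕ}

theorem cons_ne_zero_of_ne_zero (a : ℂ) {x : EuclideanSpace ℂ (Fin n)} (hx : x ≠ 0) :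
    (Fin.cons a (fun j => x j) : Fin (n + 1) → ℂ) ≠ 0 := by
  intro h
  refine hx ?_
  ext j
  simpa using congrFun h j.succ

/-- The map `(u, r) ↦ [r : u]` to the projective space, for `u ≠ 0`. -/
def projPolar (z : EuclideanSpace ℂ (Fin n) × ℝ) : Projectivization ℂ (Fin (n + 1) → ℂ) :=
  if hz : z.1 = 0 then projIota 0
  else Projectivization.mk ℂ (Fin.cons (z.2 : ℂ) (fun j => z.1 j)) (cons_ne_zero_of_ne_zero _ hz)

theorem continuous_projIota : Continuous (projIota (n := n)) := by
  refine continuous_projectivization_mk (Continuous.finCons continuous_const ?_) _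
  fun_prop

theorem continuousOn_projPolar : ContinuousOn (projPolar (n := n)) {z | z.1 ≠ 0} := by
  rw [continuousOn_iff_continuous_domRestrict]
  have : ({z | z.1 ≠ 0} : Set (EuclideanSpace ℂ (Fin n) × ℝ)).domRestrict projPolar = fun z =>
      Projectivization.mk ℂ (Fin.cons (z.1.2 : ℂ) (fun j => z.1.1 j))
        (cons_ne_zero_of_ne_zero _ z.2) := by
    ext z
    rw [domRestrict_apply, projPolar, dif_neg z.2]
  rw [this]
  refine continuous_projectivization_mk (Continuous.finCons ?_ ?_) _ <;> fun_prop

theorem projPolar_blowupInvInf {x : EuclideanSpace ℂ (Fin n)} (hx : x ≠ 0) :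
    projPolar (blowupInvInf x) = projIota x := by
  have hx' : ‖x‖⁻¹ ≠ 0 := inv_ne_zero (norm_ne_zero_iff.mpr hx)
  have hx1 : (blowupInvInf x).1 ≠ 0 := smul_ne_zero hx' hx
  rw [projPolar, dif_neg hx1, projIota, Projectivization.mk_eq_mk_iff']
  refine ⟨((‖x‖⁻¹ : ℝ) : ℂ), ?_⟩
  ext j
  refine Fin.cases ?_ (fun j => ?_) j <;> simp [blowupInvInf]

theorem projPolar_zero_eq_iff {u v : EuclideanSpace ℂ (Fin n)} (hu : u ≠ 0) (hv : v ≠ 0) :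
    projPolar (u, 0) = projPolar (v, 0) ↔ ∃ c : ℂ, c • v = u := by
  rw [projPolar, projPolar, dif_neg hu, dif_neg hv, Projectivization.mk_eq_mk_iff']
  refine exists_congr fun c => ⟨fun h => ?_, fun h => ?_⟩
  · ext j
    simpa using congrFun h j.succ
  · subst h
    ext j
    refine Fin.cases ?_ (fun j => ?_) j <;> simp

theorem projIota_injective : Function.Injective (projIota (n := n)) := by
  intro x y h
  obtain ⟨c, hc⟩ := (Projectivization.mk_eq_mk_iff' _ _ _ _ _).mp h
  have hc1 : c = 1 := by simpa using congrFun hc 0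
  ext j
  simpa [hc1] using (congrFun hc j.succ).symm

theorem projIota_ne_projPolar_zero (x : EuclideanSpace ℂ (Fin n)) {u : EuclideanSpace ℂ (Fin n)}
    (hu : u ≠ 0) : projIota x ≠ projPolar (u, 0) := by
  rw [projPolar, dif_neg hu]
  intro h
  obtain ⟨c, hc⟩ := (Projectivization.mk_eq_mk_iff' _ _ _ _ _).mp h
  simpa using congrFun hc 0

end Projective

theorem IsCompact.continuousOn_image_of_comp {α β γ : Type*} [TopologicalSpace α]
    [TopologicalSpace β] [TopologicalSpace γ] [T2Space β] {K : Set α} (hK : IsCompact K)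
    {p : α → β} (hp : ContinuousOn p K) {f : β → γ} (hf : ContinuousOn (f ∘ p) K) :
    ContinuousOn f (p '' K) := by
  rw [continuousOn_iff_isClosed]
  intro C hC
  obtain ⟨D, hD, hDK⟩ := continuousOn_iff_isClosed.mp hf C hC
  refine ⟨p '' (K ∩ D), ((hK.inter_right hD).image_of_continuousOn
    (hp.mono inter_subset_left)).isClosed, ?_⟩
  have h1 : K ∩ D = K ∩ p ⁻¹' (f ⁻¹' C) := by
    rw [inter_comm, ← hDK, preimage_comp, inter_comm]
  rw [h1, image_inter_preimage, inter_assoc, inter_comm (f ⁻¹' C), ← inter_assoc, inter_self,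
    inter_comm]

section LimitAtInfinity

variable {E F : Type*} [NormedAddCommGroup E] [NormedAddCommGroup F]

theorem tendsto_atInftyOn {X : Set E} {x : ℕ → E} (hx : ∀ i, x i ∈ X)
    (hx' : Tendsto (fun i => ‖x i‖) atTop atTop) : Tendsto x atTop (atInftyOn X) :=
  tendsto_inf.mpr ⟨tendsto_comap_iff.mpr hx', tendsto_principal.mpr (Eventually.of_forall hx)⟩

theorem BSLimit.exists_ne_zero {h : E → F} {X : Set E} (hh : BSLimit h X none none) :
    ∃ R : ℝ, 0 < R ∧ ∀ x ∈ X, R ≤ ‖x‖ → h x ≠ 0 := by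
  have h1 : ∀ᶠ x in atInftyOn X, 0 < ‖h x‖ := Tendsto.eventually_gt_atTop hh 0
  rw [atInftyOn, eventually_inf_principal, eventually_comap, eventually_atTop] at h1
  obtain ⟨R, hR⟩ := h1
  exact ⟨max R 1, by positivity, fun x hx hxR =>
    norm_pos_iff.mp (hR _ ((le_max_left R 1).trans hxR) x rfl hx)⟩

theorem BSLimit.inverse [ProperSpace E] {h : E → F} {g : F → E} {X : Set E} {Y : Set F}
    (hX : IsClosed X) (hc : ContinuousOn h X) (hg : MapsTo g Y X) (hhg : ∀ y ∈ Y, h (g y) = y) :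
    BSLimit g Y none none := by
  change Tendsto (fun y => ‖g y‖) (atInftyOn Y) atTop
  rw [tendsto_atTop]
  intro b
  rw [atInftyOn, eventually_inf_principal, eventually_comap, eventually_atTop]
  have hK : IsCompact (X ∩ Metric.closedBall 0 b) :=
    (isCompact_closedBall 0 b).inter_left hX
  obtain ⟨M, hM⟩ := (hK.image_of_continuousOn (hc.mono inter_subset_left)).isBounded.exists_norm_le
  refine ⟨M + 1, ?_⟩
  rintro _ hr y rfl hy
  by_contra! hlt
  have := hM y ⟨g y, ⟨hg hy, mem_closedBall_zero_iff.mpr hlt.le⟩, hhg y hy⟩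
  linarith

end LimitAtInfinity

section StrictTransform

variable {E F : Type*} [NormedAddCommGroup E] [NormedSpace ℝ E]
  [NormedAddCommGroup F] [NormedSpace ℝ F]

theorem blowupInvInf_mem_strictTransformInf {X : Set E} {x : E} (hx : x ∈ X) (hx0 : x ≠ 0) :
    blowupInvInf x ∈ strictTransformInf X :=
  subset_closure (mem_image_of_mem _ ⟨hx, hx0⟩)

theorem norm_blowupInvInf_fst {x : E} (hx : x ≠ 0) : ‖(blowupInvInf x).1‖ = 1 := by
  rw [blowupInvInf, norm_smul, norm_inv, norm_norm, inv_mul_cancel₀ (norm_ne_zero_iff.mpr hx)]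

theorem norm_fst_eq_one_of_mem_strictTransformInf {X : Set E} {z : E × ℝ}
    (hz : z ∈ strictTransformInf X) : ‖z.1‖ = 1 :=
  closure_minimal (t := {z : E × ℝ | ‖z.1‖ = 1})
    (by rintro _ ⟨x, hx, rfl⟩; exact norm_blowupInvInf_fst hx.2)
    (isClosed_eq (by fun_prop) continuous_const) hz

theorem snd_nonneg_of_mem_strictTransformInf {X : Set E} {z : E × ℝ}
    (hz : z ∈ strictTransformInf X) : 0 ≤ z.2 :=
  closure_minimal (t := {z : E × ℝ | 0 ≤ z.2})
    (by rintro _ ⟨x, hx, rfl⟩; exact inv_nonneg.mpr (norm_nonneg x))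
    (isClosed_le continuous_const (by fun_prop)) hz

theorem fst_ne_zero_of_mem_strictTransformInf {X : Set E} {z : E × ℝ}
    (hz : z ∈ strictTransformInf X) : z.1 ≠ 0 :=
  norm_ne_zero_iff.mp (by simp [norm_fst_eq_one_of_mem_strictTransformInf hz])

theorem ne_zero_of_mem_directionsInf {X : Set E} {u : E} (hu : u ∈ directionsInf X) : u ≠ 0 :=
  fst_ne_zero_of_mem_strictTransformInf hu

theorem exists_of_mem_strictTransformInf {X : Set E} (hX : IsClosed X) {z : E × ℝ}
    (hz : z ∈ strictTransformInf X) :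
    (∃ u ∈ directionsInf X, z = (u, 0)) ∨ ∃ x ∈ X, x ≠ 0 ∧ z = blowupInvInf x := by
  rcases (snd_nonneg_of_mem_strictTransformInf hz).eq_or_lt' with h0 | h0
  · obtain ⟨u, r⟩ := z
    obtain rfl : r = 0 := h0
    exact Or.inl ⟨u, hz, rfl⟩
  · have h1 := norm_fst_eq_one_of_mem_strictTransformInf hz
    have hc : ContinuousAt (fun w : E × ℝ => w.2⁻¹ • w.1) z :=
      (continuousAt_snd.inv₀ h0.ne').smul continuousAt_fst
    have hn : ‖z.2⁻¹ • z.1‖ = z.2⁻¹ := by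
      rw [norm_smul, h1, mul_one, Real.norm_of_nonneg (inv_nonneg.mpr h0.le)]
    refine Or.inr ⟨z.2⁻¹ • z.1, hX.closure_subset_iff.mpr ?_
      (mem_closure_image (f := fun w : E × ℝ => w.2⁻¹ • w.1) hc hz),
      smul_ne_zero (inv_ne_zero h0.ne') (fst_ne_zero_of_mem_strictTransformInf hz), ?_⟩
    · rintro _ ⟨_, ⟨x, hx, rfl⟩, rfl⟩
      simpa [blowupInvInf, smul_smul, mul_inv_cancel₀ (norm_ne_zero_iff.mpr hx.2)] using hx.1
    · rw [blowupInvInf, hn, inv_inv, smul_smul, mul_inv_cancel₀ h0.ne', one_smul]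

theorem isCompact_strictTransformInf_inter [ProperSpace E] (X : Set E) (r : ℝ) :
    IsCompact (strictTransformInf X ∩ {z | z.2 ≤ r}) := by
  refine ((isCompact_closedBall (0 : E) 1).prod (isCompact_Icc (a := (0 : ℝ)) (b := r))).of_isClosed_subset
    (isClosed_closure.inter (isClosed_le continuous_snd continuous_const)) fun z hz => ⟨?_, ?_, hz.2⟩
  · rw [mem_closedBall_zero_iff, norm_fst_eq_one_of_mem_strictTransformInf hz.1]
  · exact snd_nonneg_of_mem_strictTransformInf hz.1

theorem snd_eq_zero_of_mem_directionsInf {h : E → F} {X : Set E}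
    (hh : BSLimit h X none none) {Φ : E × ℝ → F × ℝ} (hΦc : ContinuousOn Φ (strictTransformInf X))
    (hΦ : ∀ x ∈ X, x ≠ 0 → h x ≠ 0 → Φ (blowupInvInf x) = blowupInvInf (h x))
    {u : E} (hu : u ∈ directionsInf X) : (Φ (u, 0)).2 = 0 := by
  obtain ⟨x, hx, hx1, hx2⟩ := mem_directionsInf_iff.mp hu
  have hx0 : ∀ᶠ i in atTop, x i ≠ 0 :=
    (hx1.eventually_gt_atTop 0).mono fun i hi => norm_pos_iff.mp hi
  have hhx : Tendsto (fun i => ‖h (x i)‖) atTop atTop := Tendsto.comp (f := x) (g := fun y => ‖h y‖) hh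
    (tendsto_atInftyOn hx hx1)
  have hb : Tendsto (fun i => blowupInvInf (x i)) atTop (𝓝[strictTransformInf X] (u, 0)) :=
    tendsto_nhdsWithin_iff.mpr ⟨hx2.prodMk_nhds (tendsto_inv_atTop_zero.comp hx1),
      hx0.mono fun i hi => blowupInvInf_mem_strictTransformInf (hx i) hi⟩
  have h1 := (continuous_snd.tendsto _).comp ((hΦc (u, 0) hu).tendsto.comp hb)
  refine tendsto_nhds_unique h1 ((tendsto_inv_atTop_zero.comp hhx).congr' ?_)
  filter_upwards [hx0, hhx.eventually_gt_atTop 0] with i h2 h3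
  simp only [Function.comp_apply]
  rw [hΦ _ (hx i) h2 (norm_pos_iff.mp h3), blowupInvInf]

theorem exists_mem_directionsInf_of_mem {h : E → F} {X : Set E} {Y : Set F}
    (hh : BSLimit h X none none) {Φ : E × ℝ → F × ℝ} (hΦc : ContinuousOn Φ (strictTransformInf X))
    (hΦm : MapsTo Φ (strictTransformInf X) (strictTransformInf Y))
    (hΦ : ∀ x ∈ X, x ≠ 0 → h x ≠ 0 → Φ (blowupInvInf x) = blowupInvInf (h x)) :
    ∀ u ∈ directionsInf X, ∃ v ∈ directionsInf Y, Φ (u, 0) = (v, 0) := fun u hu => by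
  have h0 : Φ (u, 0) = ((Φ (u, 0)).1, 0) :=
    Prod.ext rfl (snd_eq_zero_of_mem_directionsInf hh hΦc hΦ hu)
  refine ⟨(Φ (u, 0)).1, ?_, h0⟩
  change ((Φ (u, 0)).1, (0 : ℝ)) ∈ strictTransformInf Y
  exact h0 ▸ hΦm hu

end StrictTransform

theorem closure_image_projIota_eq {n : ℕ} {X : Set (EuclideanSpace ℂ (Fin n))} (hX : IsClosed X)
    {R : ℝ} (hR : 0 < R) : closure (projIota '' X) = projIota '' (X ∩ Metric.closedBall 0 R) ∪
      projPolar '' (strictTransformInf X ∩ {z | z.2 ≤ R⁻¹}) := by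
  refine Subset.antisymm (closure_minimal ?_ ?_) (union_subset ?_ ?_)
  · rintro _ ⟨x, hx, rfl⟩
    rcases le_or_gt ‖x‖ R with h | h
    · exact Or.inl ⟨x, ⟨hx, mem_closedBall_zero_iff.mpr h⟩, rfl⟩
    · have hx0 : x ≠ 0 := norm_pos_iff.mp (hR.trans h)
      exact Or.inr ⟨blowupInvInf x, ⟨blowupInvInf_mem_strictTransformInf hx hx0,
        inv_anti₀ hR h.le⟩, projPolar_blowupInvInf hx0⟩
  · refine IsClosed.union ?_ ?_
    · exact (((isCompact_closedBall 0 R).inter_left hX).image continuous_projIota).isClosed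
    · exact ((isCompact_strictTransformInf_inter X R⁻¹).image_of_continuousOn
        (continuousOn_projPolar.mono fun z hz => fst_ne_zero_of_mem_strictTransformInf hz.1)).isClosed
  · exact (image_mono inter_subset_left).trans subset_closure
  · rintro _ ⟨z, hz, rfl⟩
    have hz0 := fst_ne_zero_of_mem_strictTransformInf hz.1
    have hc : ContinuousAt projPolar z := continuousOn_projPolar.continuousAt
      ((isOpen_ne_fun continuous_fst continuous_const).mem_nhds hz0)
    refine closure_mono ?_ (mem_closure_image hc hz.1)
    rintro _ ⟨_, ⟨x, hx, rfl⟩, rfl⟩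
    exact ⟨x, hx.1, (projPolar_blowupInvInf hx.2).symm⟩

theorem mem_closure_image_projIota_iff {n : ℕ} {X : Set (EuclideanSpace ℂ (Fin n))}
    (hX : IsClosed X) {a : Projectivization ℂ (Fin (n + 1) → ℂ)} :
    a ∈ closure (projIota '' X) ↔
      (∃ x ∈ X, projIota x = a) ∨ ∃ u ∈ directionsInf X, projPolar (u, 0) = a := by
  rw [closure_image_projIota_eq hX one_pos]
  constructor
  · rintro (⟨x, hx, rfl⟩ | ⟨z, hz, rfl⟩)
    · exact Or.inl ⟨x, hx.1, rfl⟩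
    · rcases exists_of_mem_strictTransformInf hX hz.1 with ⟨u, hu, rfl⟩ | ⟨x, hx, hx0, rfl⟩
      · exact Or.inr ⟨u, hu, rfl⟩
      · exact Or.inl ⟨x, hx, (projPolar_blowupInvInf hx0).symm⟩
  · rintro (⟨x, hx, rfl⟩ | ⟨u, hu, rfl⟩)
    · rw [← closure_image_projIota_eq hX one_pos]
      exact subset_closure (mem_image_of_mem _ hx)
    · exact Or.inr ⟨(u, 0), ⟨hu, by simp⟩, rfl⟩

theorem projPolar_eq_of_projPolar_eq {m k : ℕ} {X : Set (EuclideanSpace ℂ (Fin m))}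
    {Y : Set (EuclideanSpace ℂ (Fin k))}
    (hX : ∀ u ∈ directionsInf X, ∀ c : ℂ, ‖c‖ = 1 → c • u ∈ directionsInf X)
    (hY : ∃ T : Set (EuclideanSpace ℂ (Fin k)), T.Finite ∧ (∀ v ∈ T, v ≠ 0) ∧
      ∀ u ∈ directionsInf Y, ∃ v ∈ T, ∃ c : ℂ, u = c • v)
    {Φ : EuclideanSpace ℂ (Fin m) × ℝ → EuclideanSpace ℂ (Fin k) × ℝ}
    (hΦc : ContinuousOn Φ (strictTransformInf X))
    (hΦD : ∀ u ∈ directionsInf X, ∃ v ∈ directionsInf Y, Φ (u, 0) = (v, 0))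
    {u u' : EuclideanSpace ℂ (Fin m)} (hu : u ∈ directionsInf X) (hu' : u' ∈ directionsInf X)
    (h : projPolar (u, 0) = projPolar (u', 0)) :
    projPolar (Φ (u, 0)) = projPolar (Φ (u', 0)) := by
  obtain ⟨T, hT, hT0, hTY⟩ := hY
  obtain ⟨c, rfl⟩ := (projPolar_zero_eq_iff (ne_zero_of_mem_directionsInf hu)
    (ne_zero_of_mem_directionsInf hu')).mp h
  have hc : c ∈ Metric.sphere (0 : ℂ) 1 := by
    have := norm_eq_one_of_mem_directionsInf hu
    rwa [norm_smul, norm_eq_one_of_mem_directionsInf hu', mul_one, ← mem_sphere_zero_iff_norm]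
      at this
  let f : ℂ → Projectivization ℂ (Fin (k + 1) → ℂ) := fun c => projPolar (Φ (c • u', 0))
  have hmem : ∀ c ∈ Metric.sphere (0 : ℂ) 1, c • u' ∈ directionsInf X := fun c hc =>
    hX u' hu' c (mem_sphere_zero_iff_norm.mp hc)
  have hf : ContinuousOn f (Metric.sphere 0 1) := by
    refine continuousOn_projPolar.comp (hΦc.comp (t := strictTransformInf X) (by fun_prop) hmem) fun c hc => ?_
    obtain ⟨v, hv, hv'⟩ := hΦD _ (hmem c hc)
    simp only [mem_ofPred_eq, hv']
    exact ne_zero_of_mem_directionsInf hv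
  have hconn : IsPreconnected (f '' Metric.sphere 0 1) :=
    (isPreconnected_sphere (by simp [Complex.rank_real_complex]) 0 1).image f hf
  have hfin : (f '' Metric.sphere 0 1).Finite := by
    refine (hT.image fun v => projPolar (v, 0)).subset ?_
    rintro _ ⟨c, hc, rfl⟩
    obtain ⟨v, hv, hv'⟩ := hΦD _ (hmem c hc)
    obtain ⟨t, ht, a, rfl⟩ := hTY v hv
    refine ⟨t, ht, ?_⟩
    simp only [f, hv']
    exact ((projPolar_zero_eq_iff (ne_zero_of_mem_directionsInf hv) (hT0 t ht)).mpr ⟨a, rfl⟩).symm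
  have hsub : (f '' Metric.sphere 0 1).Subsingleton := by
    by_contra hns
    exact hconn.infinite_of_nontrivial (not_subsingleton_iff.mp hns) hfin
  have := hsub (mem_image_of_mem f hc) (mem_image_of_mem f (by simp : (1 : ℂ) ∈ _))
  simpa only [f, one_smul] using this

theorem exists_extension_closure_image_projIota {m k : ℕ} {X : Set (EuclideanSpace ℂ (Fin m))}
    {Y : Set (EuclideanSpace ℂ (Fin k))} (hXc : IsClosed X)
    (hX : ∀ u ∈ directionsInf X, ∀ c : ℂ, ‖c‖ = 1 → c • u ∈ directionsInf X)
    (hY : ∃ T : Set (EuclideanSpace ℂ (Fin k)), T.Finite ∧ (∀ v ∈ T, v ≠ 0) ∧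
      ∀ u ∈ directionsInf Y, ∃ v ∈ T, ∃ c : ℂ, u = c • v)
    {h : EuclideanSpace ℂ (Fin m) → EuclideanSpace ℂ (Fin k)} (hc : ContinuousOn h X)
    (hh : BSLimit h X none none)
    {Φ : EuclideanSpace ℂ (Fin m) × ℝ → EuclideanSpace ℂ (Fin k) × ℝ}
    (hΦc : ContinuousOn Φ (strictTransformInf X))
    (hΦm : MapsTo Φ (strictTransformInf X) (strictTransformInf Y))
    (hΦ : ∀ x ∈ X, x ≠ 0 → h x ≠ 0 → Φ (blowupInvInf x) = blowupInvInf (h x)) :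
    ∃ H : Projectivization ℂ (Fin (m + 1) → ℂ) → Projectivization ℂ (Fin (k + 1) → ℂ),
      (∀ x ∈ X, H (projIota x) = projIota (h x)) ∧
      (∀ u ∈ directionsInf X, H (projPolar (u, 0)) = projPolar (Φ (u, 0))) ∧
      ContinuousOn H (closure (projIota '' X)) := by
  have hΦD := exists_mem_directionsInf_of_mem hh hΦc hΦm hΦ
  have hex : ∀ a, ∃ b, (∀ x ∈ X, projIota x = a → b = projIota (h x)) ∧
      ∀ u ∈ directionsInf X, projPolar (u, 0) = a → b = projPolar (Φ (u, 0)) := by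
    intro a
    by_cases ha : ∃ x ∈ X, projIota x = a
    · obtain ⟨x, hx, rfl⟩ := ha
      refine ⟨projIota (h x), fun y _ hy => by rw [projIota_injective hy], fun u hu hux => ?_⟩
      exact absurd hux.symm (projIota_ne_projPolar_zero x (ne_zero_of_mem_directionsInf hu))
    by_cases ha' : ∃ u ∈ directionsInf X, projPolar (u, 0) = a
    · obtain ⟨u, hu, rfl⟩ := ha'
      exact ⟨projPolar (Φ (u, 0)), fun x hx hxa => absurd ⟨x, hx, hxa⟩ ha, fun v hv hvu =>
        projPolar_eq_of_projPolar_eq hX hY hΦc hΦD hu hv hvu.symm⟩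
    · exact ⟨projIota 0, fun x hx hxa => absurd ⟨x, hx, hxa⟩ ha,
        fun u hu hua => absurd ⟨u, hu, hua⟩ ha'⟩
  choose H hH1 hH2 using hex
  have hH1 : ∀ x ∈ X, H (projIota x) = projIota (h x) := fun x hx => hH1 _ x hx rfl
  have hH2 : ∀ u ∈ directionsInf X, H (projPolar (u, 0)) = projPolar (Φ (u, 0)) :=
    fun u hu => hH2 _ u hu rfl
  refine ⟨H, hH1, hH2, ?_⟩
  obtain ⟨R, hR, hR0⟩ := hh.exists_ne_zero
  have hK1 : IsCompact (X ∩ Metric.closedBall 0 R) := (isCompact_closedBall 0 R).inter_left hXc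
  have hK2 := isCompact_strictTransformInf_inter X R⁻¹
  have hp : ContinuousOn projPolar (strictTransformInf X ∩ {z | z.2 ≤ R⁻¹}) :=
    continuousOn_projPolar.mono fun z hz => fst_ne_zero_of_mem_strictTransformInf hz.1
  rw [closure_image_projIota_eq hXc hR]
  refine ContinuousOn.union_of_isClosed ?_ ?_ (hK1.image continuous_projIota).isClosed
    (hK2.image_of_continuousOn hp).isClosed
  · refine hK1.continuousOn_image_of_comp continuous_projIota.continuousOn ?_
    exact (continuous_projIota.comp_continuousOn (hc.mono inter_subset_left)).congr
      fun x hx => hH1 x hx.1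
  · refine hK2.continuousOn_image_of_comp hp ?_
    have hpΦ : ContinuousOn (projPolar ∘ Φ) (strictTransformInf X ∩ {z | z.2 ≤ R⁻¹}) :=
      continuousOn_projPolar.comp (hΦc.mono inter_subset_left)
        fun z hz => fst_ne_zero_of_mem_strictTransformInf (hΦm hz.1)
    refine hpΦ.congr fun z hz => ?_
    rcases exists_of_mem_strictTransformInf hXc hz.1 with ⟨u, hu, rfl⟩ | ⟨x, hx, hx0, rfl⟩
    · exact hH2 u hu
    · have hx' := hR0 x hx ((inv_le_inv₀ (norm_pos_iff.mpr hx0) hR).mp hz.2)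
      simp only [Function.comp_apply]
      rw [projPolar_blowupInvInf hx0, hH1 x hx, hΦ x hx hx0 hx', projPolar_blowupInvInf hx']

section Curve

variable {n : ℕ} {X : Set (EuclideanSpace ℂ (Fin n))}

theorem IsComplexAlgebraic.isClosed (hX : IsComplexAlgebraic X) : IsClosed X := by
  obtain ⟨m, P, rfl⟩ := hX
  rw [ofPred_forall]
  refine isClosed_iInter fun i => isClosed_eq ?_ continuous_const
  exact (MvPolynomial.continuous_eval (P i)).comp (by fun_prop)

theorem IsComplexAlgebraicCurve.smul_mem_directionsInf (hX : IsComplexAlgebraicCurve X)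
    {u : EuclideanSpace ℂ (Fin n)} (hu : u ∈ directionsInf X) {c : ℂ} (hc : ‖c‖ = 1) :
    c • u ∈ directionsInf X := by
  obtain ⟨S, hS, hSp, rfl⟩ := hX.exists_finite_primes
  rw [directionsInf_iUnion hS] at hu ⊢
  simp only [mem_iUnion, exists_prop] at hu ⊢
  obtain ⟨p, hp, hup⟩ := hu
  have := (hSp p hp).1
  exact ⟨p, hp, smul_mem_directionsInf_algSet (hSp p hp).2 hup hc⟩

theorem IsComplexAlgebraicCurve.exists_finite_directions (hX : IsComplexAlgebraicCurve X) :
    ∃ T : Set (EuclideanSpace ℂ (Fin n)), T.Finite ∧ (∀ v ∈ T, v ≠ 0) ∧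
      ∀ u ∈ directionsInf X, ∃ v ∈ T, ∃ c : ℂ, u = c • v := by
  obtain ⟨S, hS, hSp, rfl⟩ := hX.exists_finite_primes
  have hex : ∀ p ∈ S, ∃ T : Set (EuclideanSpace ℂ (Fin n)), T.Finite ∧ (∀ v ∈ T, v ≠ 0) ∧
      ∀ u ∈ directionsInf (algSet p), ∃ v ∈ T, ∃ c : ℂ, u = c • v := fun p hp =>
    have := (hSp p hp).1
    exists_finite_directions_of_noPrimeChain (hSp p hp).2
  choose! T hT hT0 hTD using hex
  refine ⟨⋃ p ∈ S, T p, hS.biUnion hT, fun v hv => ?_, fun u hu => ?_⟩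
  · simp only [mem_iUnion, exists_prop] at hv
    obtain ⟨p, hp, hv⟩ := hv
    exact hT0 p hp v hv
  · rw [directionsInf_iUnion hS] at hu
    simp only [mem_iUnion, exists_prop] at hu ⊢
    obtain ⟨p, hp, hu⟩ := hu
    obtain ⟨v, hv, h⟩ := hTD p hp u hu
    exact ⟨v, ⟨p, hp, hv⟩, h⟩

end Curve

theorem leftInvOn_extensions {m k : ℕ} {X : Set (EuclideanSpace ℂ (Fin m))}
    {Y : Set (EuclideanSpace ℂ (Fin k))} (hXc : IsClosed X) (hYc : IsClosed Y)
    {h : EuclideanSpace ℂ (Fin m) → EuclideanSpace ℂ (Fin k)}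
    {g : EuclideanSpace ℂ (Fin k) → EuclideanSpace ℂ (Fin m)} (hm : MapsTo h X Y)
    (hgh : ∀ x ∈ X, g (h x) = x)
    {Φ : EuclideanSpace ℂ (Fin m) × ℝ → EuclideanSpace ℂ (Fin k) × ℝ}
    {Ψ : EuclideanSpace ℂ (Fin k) × ℝ → EuclideanSpace ℂ (Fin m) × ℝ}
    (hΦD : ∀ u ∈ directionsInf X, ∃ v ∈ directionsInf Y, Φ (u, 0) = (v, 0))
    (hΨΦ : ∀ z ∈ strictTransformInf X, Ψ (Φ z) = z)
    {H : Projectivization ℂ (Fin (m + 1) → ℂ) → Projectivization ℂ (Fin (k + 1) → ℂ)}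
    {G : Projectivization ℂ (Fin (k + 1) → ℂ) → Projectivization ℂ (Fin (m + 1) → ℂ)}
    (hH1 : ∀ x ∈ X, H (projIota x) = projIota (h x))
    (hH2 : ∀ u ∈ directionsInf X, H (projPolar (u, 0)) = projPolar (Φ (u, 0)))
    (hG1 : ∀ y ∈ Y, G (projIota y) = projIota (g y))
    (hG2 : ∀ v ∈ directionsInf Y, G (projPolar (v, 0)) = projPolar (Ψ (v, 0))) :
    MapsTo H (closure (projIota '' X)) (closure (projIota '' Y)) ∧
      ∀ a ∈ closure (projIota '' X), G (H a) = a := by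
  refine forall₂_and.mp ?_
  intro a ha
  rw [mem_closure_image_projIota_iff hYc]
  rcases (mem_closure_image_projIota_iff hXc).mp ha with ⟨x, hx, rfl⟩ | ⟨u, hu, rfl⟩
  · rw [hH1 x hx, hG1 _ (hm hx), hgh x hx]
    exact ⟨Or.inl ⟨h x, hm hx, rfl⟩, rfl⟩
  · obtain ⟨v, hv, huv⟩ := hΦD u hu
    rw [hH2 u hu, huv, hG2 v hv, ← huv, hΨΦ _ hu, huv]
    exact ⟨Or.inr ⟨v, hv, rfl⟩, rfl⟩

/-- a blow-spherical homeomorphism at infinity between complex algebraic curves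
extends to a homeomorphism between their projective closures. -/
theorem bs_at_infinity_extends_to_projective_closure {m k : ℕ}
    (X : Set (EuclideanSpace ℂ (Fin m))) (Y : Set (EuclideanSpace ℂ (Fin k)))
    (hX : IsComplexAlgebraicCurve X) (hY : IsComplexAlgebraicCurve Y)
    (h : EuclideanSpace ℂ (Fin m) → EuclideanSpace ℂ (Fin k))
    (hbs : IsBSHomeoAtO h X Y none none) :
    ∃ H : Projectivization ℂ (Fin (m + 1) → ℂ) → Projectivization ℂ (Fin (k + 1) → ℂ),
      IsHomeoOn H (closure (projIota '' X)) (closure (projIota '' Y)) ∧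
      ∀ x ∈ X, H (projIota x) = projIota (h x) := by
  obtain ⟨⟨hbij, hc, g, hgh, hhg, hgc⟩, hlim, Φ, ⟨hΦbij, hΦc, Ψ, hΨΦ, hΦΨ, hΨc⟩, hΦ⟩ := hbs
  simp only [strictTransformO, blowupInvO, IsCenter] at hΦbij hΦc hΨΦ hΦΨ hΨc hΦ
  have hXc := hX.1.isClosed
  have hYc := hY.1.isClosed
  have hg : MapsTo g Y X := fun y hy => by
    obtain ⟨x, hx, rfl⟩ := hbij.surjOn hy
    rwa [hgh x hx]
  have hΨm : MapsTo Ψ (strictTransformInf Y) (strictTransformInf X) := fun w hw => by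
    obtain ⟨z, hz, rfl⟩ := hΦbij.surjOn hw
    rwa [hΨΦ z hz]
  have hlim' : BSLimit g Y none none := BSLimit.inverse hXc hc hg hhg
  have hΨ : ∀ y ∈ Y, y ≠ 0 → g y ≠ 0 → Ψ (blowupInvInf y) = blowupInvInf (g y) := by
    intro y hy hy0 hgy0
    have h1 := hΦ (g y) (hg hy) hgy0 (by rwa [hhg y hy])
    rw [hhg y hy] at h1
    rw [← h1, hΨΦ _ (blowupInvInf_mem_strictTransformInf (hg hy) hgy0)]
  have hΦD := exists_mem_directionsInf_of_mem hlim hΦc hΦbij.mapsTo hΦ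
  have hΨD := exists_mem_directionsInf_of_mem hlim' hΨc hΨm hΨ
  obtain ⟨H, hH1, hH2, hHc⟩ := exists_extension_closure_image_projIota hXc
    (fun u hu c => hX.smul_mem_directionsInf hu) hY.exists_finite_directions hc hlim hΦc
    hΦbij.mapsTo hΦ
  obtain ⟨G, hG1, hG2, hGc⟩ := exists_extension_closure_image_projIota hYc
    (fun u hu c => hY.smul_mem_directionsInf hu) hX.exists_finite_directions hgc hlim' hΨc hΨm hΨ
  obtain ⟨hHm, hGH⟩ := leftInvOn_extensions hXc hYc hbij.mapsTo hgh hΦD hΨΦ hH1 hH2 hG1 hG2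
  obtain ⟨hGm, hHG⟩ := leftInvOn_extensions hYc hXc hg hhg hΨD hΦΨ hG1 hG2 hH1 hH2
  exact ⟨H, ⟨InvOn.bijOn ⟨hGH, hHG⟩ hHm hGm, hHc, G, hGH, hHG, hGc⟩, hH1⟩

end
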